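/- arXiv:2111.02295 — 2 statements merged into one kernel-verified Lean document; each statement's English description precedes it below -/
import Mathlib

section
/- Let H be a minimal feasible solution to an LC-SNDP instance with graph G, terminal set R, and demands d_{s,t}. Then there exist subtrees T₁,…,T_b of H such that H = ⋃_{i=1}^b T_i, no two of the trees share a Steiner vertex, every leaf of every tree is a terminal, and every internal vertex of every tree is a Steiner vertex. Moreover, for every terminal pair s,t ∈ R there exist d_{s,t} pairwise element-disjoint s–t paths in H such that the edge set of each tree T_i (i ∈ {1,…,b}) intersects the edge set of at most one of these paths. -/
open SimpleGraph

/-- A family of `n` pairwise element-disjoint `s`-`t` paths with respect to the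
terminal set `R`: the paths are pairwise disjoint on edges and on vertices
outside `R`. -/
def ElemDisjPaths {V : Type*} (G : SimpleGraph V) (R : Set V) (s t : V) (n : ℕ)
    (P : Fin n → G.Walk s t) : Prop :=
  (∀ i, (P i).IsPath) ∧ ∀ i j, i ≠ j →
    (∀ e, e ∈ (P i).edges → e ∉ (P j).edges) ∧
    (∀ v, v ∈ (P i).support → v ∈ (P j).support → v ∈ R)

/-- The element-connectivity `κ'_G(s,t)` w.r.t. the terminal set `R`: the
maximum number of pairwise element-disjoint `s`-`t` paths. -/
noncomputable def elemConn {V : Type*} (G : SimpleGraph V) (R : Set V) (s t : V) : ℕ :=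
  sSup {n | ∃ P : Fin n → G.Walk s t, ElemDisjPaths G R s t n P}

/-- Feasibility for LC-SNDP: the subgraph `H` satisfies all element-connectivity
demands between distinct terminal pairs. -/
def LCFeasible {V : Type*} (H : SimpleGraph V) (R : Set V) (d : V → V → ℕ) : Prop :=
  ∀ s ∈ R, ∀ t ∈ R, s ≠ t → d s t ≤ elemConn H R s t

/-- **Menger's theorem** for a relation on a finite type: if every set avoiding `Y` has at least
`n` elements on its outer boundary (elements of `X` counting as entry points), then there are `n`
disjoint sets, each containing a chain from `X` to `Y`. -/
theorem exists_disjoint_chains {α : Type*} [Finite α] (r : α → α → Prop) (X Y : Set α) (n : ℕ)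
    (h : ∀ S : Set α, Disjoint S Y → n ≤ {b | b ∉ S ∧ (b ∈ X ∨ ∃ a ∈ S, r a b)}.ncard) :
    ∃ P : Fin n → Set α, (∀ i j, i ≠ j → Disjoint (P i) (P j)) ∧
      ∀ i, ∃ x ∈ X ∩ P i, ∃ y ∈ Y ∩ P i,
        Relation.ReflTransGen (fun a b => r a b ∧ b ∈ P i) x y := by
  classical
  have := Fintype.ofFinite α
  let N : α ⊕ Fin n → α ⊕ Fin n → Prop := fun a b => match a, b with
    | .inr _, .inl b => b ∈ X
    | .inl a, .inl b => a = b ∨ r a b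
    | .inl a, .inr _ => a ∈ Y
    | .inr _, .inr _ => False
  obtain ⟨f, hf, hN⟩ : ∃ f : α ⊕ Fin n → α ⊕ Fin n, Function.Injective f ∧ ∀ a, N a (f a) := by
    have := (Finset.all_card_le_biUnion_card_iff_exists_injective
      (fun a => Finset.univ.filter (N a))).1 ?_
    · simpa using this
    intro S
    have hS : S.card = S.toLeft.card + S.toRight.card := S.card_toLeft_add_card_toRight.symm
    have hr : S.toRight.card ≤ n := by simpa using S.toRight.card_le_univ
    set T := S.biUnion fun a => Finset.univ.filter (N a) with hT
    have memT : ∀ b, b ∈ T ↔ ∃ a ∈ S, N a b := by simp [hT]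
    have hsub : S.toLeft ⊆ T.toLeft := by
      intro a ha
      rw [Finset.mem_toLeft] at ha ⊢
      exact (memT _).2 ⟨_, ha, Or.inl rfl⟩
    have hTc : T.card = T.toLeft.card + T.toRight.card := T.card_toLeft_add_card_toRight.symm
    have hle := Finset.card_le_card hsub
    rcases S.toRight.eq_empty_or_nonempty with h0 | ⟨i, hi⟩
    · rw [h0, Finset.card_empty] at hS
      omega
    by_cases hY : ∃ a ∈ S.toLeft, a ∈ Y
    · obtain ⟨a, ha, haY⟩ := hY
      have : T.toRight = Finset.univ := by
        ext j
        simpa using (memT _).2 ⟨.inl a, by simpa using ha, haY⟩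
      rw [this, Finset.card_univ, Fintype.card_fin] at hTc
      omega
    · have h1 := h (S.toLeft : Set α) (by
        rw [Set.disjoint_left]
        exact fun a ha haY => hY ⟨a, ha, haY⟩)
      have h2 : {b | b ∉ (S.toLeft : Set α) ∧ (b ∈ X ∨ ∃ a ∈ (S.toLeft : Set α), r a b)} ⊆
          ((T.toLeft \ S.toLeft : Finset α) : Set α) := by
        rintro b ⟨hb, hb'⟩
        have : b ∈ T.toLeft := by
          rw [Finset.mem_toLeft, memT]
          rcases hb' with hb' | ⟨a, ha, hab⟩
          · exact ⟨.inr i, by simpa using hi, hb'⟩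
          · exact ⟨.inl a, by simpa using ha, Or.inr hab⟩
        simp only [Finset.coe_sdiff, Set.mem_sdiff]
        exact ⟨by exact_mod_cast this, hb⟩
      have h3 := Set.ncard_le_ncard h2 (Set.toFinite _)
      rw [Set.ncard_coe_finset, Finset.card_sdiff_of_subset hsub] at h3
      omega
  have hret : ∀ i : Fin n, ∃ m, 0 < m ∧ ∃ j, f^[m] (.inr i) = .inr j := by
    intro i
    obtain ⟨m, hm, hm'⟩ := (Function.mem_periodicPts).1 (hf.mem_periodicPts (.inr i))
    exact ⟨m, hm, i, hm'⟩
  have hmin : ∀ i k, 0 < k → k < Nat.find (hret i) → ∃ a, f^[k] (.inr i) = .inl a := by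
    intro i k hk hk'
    have := Nat.find_min (hret i) hk'
    rcases hfk : f^[k] (.inr i) with a | j
    · exact ⟨a, rfl⟩
    · exact absurd ⟨hk, j, hfk⟩ this
  refine ⟨fun i => {a | ∃ k, 0 < k ∧ k < Nat.find (hret i) ∧ f^[k] (.inr i) = .inl a}, ?_, ?_⟩
  · have key : ∀ i j k l, k ≤ l → l < Nat.find (hret j) → f^[k] (.inr i) = f^[l] (.inr j) →
        i = j := by
      intro i j k l hkl hl heq
      obtain ⟨m, rfl⟩ := Nat.exists_eq_add_of_le hkl
      rw [Function.iterate_add_apply] at heq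
      have h1 := (hf.iterate k) heq
      rcases Nat.eq_zero_or_pos m with rfl | hm
      · simpa using h1
      · obtain ⟨a, ha⟩ := hmin j m hm (by omega)
        rw [ha] at h1
        cases h1
    intro i j hij
    rw [Set.disjoint_left]
    rintro a ⟨k, -, hk, hka⟩ ⟨l, -, hl, hla⟩
    rcases le_total k l with hkl | hkl
    · exact hij (key i j k l hkl hl (hka.trans hla.symm))
    · exact hij (key j i l k hkl hk (hla.trans hka.symm)).symm
  · intro i
    obtain ⟨hm0, j, hj⟩ := Nat.find_spec (hret i)
    set m := Nat.find (hret i) with hm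
    have h1 := hN (.inr i)
    rcases hx : f (.inr i) with x | _
    swap
    · rw [hx] at h1
      exact h1.elim
    rw [hx] at h1
    have hm1 : 1 < m := by
      rcases Nat.lt_or_ge 1 m with h | h
      · exact h
      · have : m = 1 := by omega
        rw [this, Function.iterate_one, hx] at hj
        cases hj
    have chain : ∀ k, 0 < k → k < m → ∃ a, f^[k] (.inr i) = .inl a ∧
        Relation.ReflTransGen (fun a b => r a b ∧
          ∃ k, 0 < k ∧ k < m ∧ f^[k] (.inr i) = .inl b) x a := by
      intro k hk
      induction k, hk using Nat.le_induction with
      | base => exact fun _ => ⟨x, by simpa using hx, .refl⟩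
      | succ k hk ih =>
        intro hk'
        obtain ⟨a, ha, hxa⟩ := ih (by omega)
        obtain ⟨b, hb⟩ := hmin i (k + 1) (by omega) hk'
        refine ⟨b, hb, ?_⟩
        have h2 := hN (.inl a)
        rw [← ha, ← Function.iterate_succ_apply' f, hb, ha] at h2
        rcases h2 with rfl | h2
        · exact hxa
        · exact hxa.tail ⟨h2, k + 1, by omega, hk', hb⟩
    obtain ⟨y, hy, hxy⟩ := chain (m - 1) (by omega) (by omega)
    refine ⟨x, ⟨h1, 1, one_pos, hm1, by simpa using hx⟩, y,
      ⟨?_, m - 1, by omega, by omega, hy⟩, hxy⟩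
    have h2 := hN (.inl y)
    rw [← hy, ← Function.iterate_succ_apply' f, Nat.succ_eq_add_one,
      Nat.sub_add_cancel hm0, hj, hy] at h2
    exact h2

section ElementConnectivity

variable {V : Type*}

lemma SimpleGraph.Walk.reachable_of_forall_mem_edges {K K' : SimpleGraph V} {s t : V}
    (w : K.Walk s t) (φ : V → V) (h : ∀ a b, s(a, b) ∈ w.edges → K'.Reachable (φ a) (φ b)) :
    K'.Reachable (φ s) (φ t) := by
  induction w with
  | nil => exact .rfl
  | cons hab p ih =>
    exact (h _ _ (by simp)).trans (ih fun a b he => h a b (by simp [he]))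

lemma SimpleGraph.Walk.exists_adj_of_mem_support {K : SimpleGraph V} {s t v : V} (w : K.Walk s t)
    (hst : s ≠ t) (hv : v ∈ w.support) : ∃ u, K.Adj v u := by
  obtain ⟨e, he, hve⟩ := (w.mem_support_iff_exists_mem_edges_of_not_nil
    (SimpleGraph.Walk.not_nil_of_ne hst)).1 hv
  obtain ⟨u, rfl⟩ := hve
  exact ⟨u, w.adj_of_mem_edges he⟩

/-- Edge-disjoint subgraphs connecting `s` and `t` contain edge-disjoint paths, whose vertices are
non-isolated in the respective subgraphs. -/
lemma exists_paths_of_reachable {H : SimpleGraph V} {s t : V} {n : ℕ} (hst : s ≠ t)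
    (K : Fin n → SimpleGraph V) (hKH : ∀ i, K i ≤ H) (hK : ∀ i, (K i).Reachable s t)
    (hdisj : ∀ i j, i ≠ j → ∀ u v, (K i).Adj u v → ¬ (K j).Adj u v) :
    ∃ P : Fin n → H.Walk s t, (∀ i, (P i).IsPath) ∧
      (∀ i j, i ≠ j → ∀ e, e ∈ (P i).edges → e ∉ (P j).edges) ∧
      ∀ i, ∀ v ∈ (P i).support, ∃ u, (K i).Adj v u := by
  classical
  choose w hw using fun i => (hK i).exists_isPath
  refine ⟨fun i => (w i).mapLe (hKH i), fun i => (hw i).mapLe _, ?_, ?_⟩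
  · intro i j hij e hei hej
    rw [Walk.edges_mapLe_eq_edges] at hei hej
    induction e with
    | h u v => exact hdisj i j hij u v ((w i).adj_of_mem_edges hei) ((w j).adj_of_mem_edges hej)
  · intro i v hv
    rw [Walk.support_mapLe_eq_support] at hv
    exact (w i).exists_adj_of_mem_support hst hv

lemma ElemDisjPaths.exists_of_reachable {H : SimpleGraph V} {R : Set V} {s t : V} {n : ℕ}
    (hst : s ≠ t) (K : Fin n → SimpleGraph V) (hKH : ∀ i, K i ≤ H)
    (hK : ∀ i, (K i).Reachable s t)
    (hdisj : ∀ i j, i ≠ j → ∀ u v, (K i).Adj u v → ¬ (K j).Adj u v)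
    (hvert : ∀ i j, i ≠ j → ∀ v u w, (K i).Adj v u → (K j).Adj v w → v ∈ R) :
    ∃ P : Fin n → H.Walk s t, ElemDisjPaths H R s t n P := by
  obtain ⟨P, hP, hPe, hPv⟩ := exists_paths_of_reachable hst K hKH hK hdisj
  refine ⟨P, hP, fun i j hij => ⟨hPe i j hij, fun v hi hj => ?_⟩⟩
  obtain ⟨u, hu⟩ := hPv i v hi
  obtain ⟨w, hw⟩ := hPv j v hj
  exact hvert i j hij v u w hu hw

lemma bddAbove_elemDisjPaths [Finite V] (H : SimpleGraph V) (R : Set V) {s t : V} (hst : s ≠ t) :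
    BddAbove {n | ∃ P : Fin n → H.Walk s t, ElemDisjPaths H R s t n P} := by
  refine ⟨Nat.card (Sym2 V), ?_⟩
  rintro n ⟨P, -, hP⟩
  have : ∀ i, ∃ e, e ∈ (P i).edges := by
    intro i
    obtain ⟨e, he, -⟩ := ((P i).mem_support_iff_exists_mem_edges_of_not_nil
      (SimpleGraph.Walk.not_nil_of_ne hst)).1 (P i).start_mem_support
    exact ⟨e, he⟩
  choose e he using this
  have hinj : Function.Injective e := by
    intro i j hij
    by_contra hne
    exact (hP i j hne).1 _ (he i) (hij ▸ he j)
  simpa using Nat.card_le_card_of_injective e hinj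

lemma le_elemConn_iff [Finite V] {H : SimpleGraph V} {R : Set V} {s t : V} (hst : s ≠ t) {n : ℕ} :
    n ≤ elemConn H R s t ↔ ∃ P : Fin n → H.Walk s t, ElemDisjPaths H R s t n P := by
  have hbdd := bddAbove_elemDisjPaths H R hst
  constructor
  · intro h
    have hne : {n | ∃ P : Fin n → H.Walk s t, ElemDisjPaths H R s t n P}.Nonempty :=
      ⟨0, fun i => i.elim0, fun i => i.elim0, fun i => i.elim0⟩
    obtain ⟨P, hP, hP'⟩ := Nat.sSup_mem hne hbdd
    refine ⟨fun i => P (Fin.castLE h i), fun i => hP _, fun i j hij => hP' _ _ ?_⟩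
    exact fun h' => hij (Fin.castLE_injective h h')
  · exact fun h => le_csSup hbdd h

/-- The edges of `H` between `A` and `B`. -/
def crossEdges (H : SimpleGraph V) (A B : Set V) : Set (Sym2 V) :=
  {e | e ∈ H.edgeSet ∧ ∃ u ∈ A, ∃ v ∈ B, e = s(u, v)}

/-- The number of elements separating `A` from `B`, where each fibre of `c` outside `A ∪ B`
counts as one element. -/
noncomputable def cutValue (H : SimpleGraph V) (c : V → V) (A B : Set V) : ℕ :=
  (c '' (A ∪ B)ᶜ).ncard + (crossEdges H A B).ncard

/-- Two disjoint sets that together contain all terminals and are unions of fibres of `c`. -/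
structure IsBicut (R : Set V) (c : V → V) (A B : Set V) : Prop where
  disj : ∀ v ∈ A, v ∉ B
  cover : ∀ v ∈ R, v ∈ A ∨ v ∈ B
  left : ∀ u v, c u = c v → u ∈ A → v ∈ A
  right : ∀ u v, c u = c v → u ∈ B → v ∈ B

/-- The cut condition for the graph obtained from `H` by contracting the fibres of `c`. -/
def CutFeasible (H : SimpleGraph V) (R : Set V) (c : V → V) (d : V → V → ℕ) : Prop :=
  ∀ s ∈ R, ∀ t ∈ R, ∀ A B, IsBicut R c A B → s ∈ A → t ∈ B → d s t ≤ cutValue H c A B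

/-- The edges of `H` inside the fibres of `c`. -/
def fibreGraph (H : SimpleGraph V) (c : V → V) : SimpleGraph V where
  Adj u v := H.Adj u v ∧ c u = c v
  symm := ⟨fun _ _ h => ⟨h.1.symm, h.2.symm⟩⟩
  loopless := ⟨fun _ h => h.1.ne rfl⟩

/-- The fibres of `c` are singleton terminals and connected sets of Steiner vertices. -/
structure IsContraction (H : SimpleGraph V) (R : Set V) (c : V → V) : Prop where
  terminal : ∀ u ∈ R, ∀ v, c u = c v → u = v
  conn : ∀ u v, c u = c v → (fibreGraph H c).Reachable u v

lemma IsContraction.reachable {H K : SimpleGraph V} {R : Set V} {c : V → V}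
    (hc : IsContraction H R c) {u v : V} (huv : c u = c v)
    (hK : ∀ a b, H.Adj a b → c a = c u → c b = c u → K.Adj a b) : K.Reachable u v := by
  obtain ⟨w⟩ := hc.conn u v huv
  induction w with
  | nil => exact .rfl
  | @cons a b _ hab p ih =>
    have hab' : H.Adj a b ∧ c a = c b := hab
    refine (hK a b hab'.1 rfl hab'.2.symm).reachable.trans (ih (hab'.2.symm.trans huv) ?_)
    rwa [← hab'.2]

/-- Menger's theorem for the contracted graph, with the paths lifted to `H`. -/
lemma IsContraction.exists_paths [Finite V] {H : SimpleGraph V} {R : Set V} {c : V → V}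
    (hc : IsContraction H R c) {s t : V} (hs : s ∈ R) (ht : t ∈ R) (hst : s ≠ t) {n : ℕ}
    (hcut : ∀ A B, IsBicut R c A B → s ∈ A → t ∈ B → n ≤ cutValue H c A B) :
    ∃ P : Fin n → H.Walk s t, (∀ i, (P i).IsPath) ∧
      (∀ i j, i ≠ j → ∀ e, e ∈ (P i).edges → e ∉ (P j).edges) ∧
      ∀ i j, i ≠ j → ∀ u ∈ (P i).support, ∀ v ∈ (P j).support, c u = c v → u ∈ R := by
  let r : V ⊕ Sym2 V → V ⊕ Sym2 V → Prop := fun a b => match a, b with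
    | .inl _, .inl _ => False
    | .inl l, .inr e => e ∈ H.edgeSet ∧ ∃ u ∈ e, u ∉ R ∧ c u = l
    | .inr e, .inl l => ∃ u ∈ e, u ∉ R ∧ c u = l
    | .inr e, .inr e' => e' ∈ H.edgeSet ∧ ∃ u ∈ e, u ∈ e' ∧ u ∈ R
  have hcR : ∀ u v, c u = c v → u ∉ R → v ∉ R := fun u v huv hu hv =>
    hu (hc.terminal v hv u huv.symm ▸ hv)
  obtain ⟨P, hPd, hP⟩ := exists_disjoint_chains r
    {a | ∃ e ∈ H.edgeSet, s ∈ e ∧ a = .inr e} {a | ∃ e, t ∈ e ∧ a = .inr e} n (by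
    intro S hS
    rw [Set.disjoint_left] at hS
    set Z := {b | b ∉ S ∧ (b ∈ {a | ∃ e ∈ H.edgeSet, s ∈ e ∧ a = .inr e} ∨ ∃ a ∈ S, r a b)}
      with hZ
    let A : Set V := {v | v = s ∨ (v ∈ R ∧ ∃ e, .inr e ∈ S ∧ v ∈ e) ∨ (v ∉ R ∧ .inl (c v) ∈ S)}
    let B : Set V := {v | v ∉ A ∧ ¬ (v ∉ R ∧ .inl (c v) ∈ Z)}
    have hAsat : ∀ u v, c u = c v → u ∈ A → v ∈ A := by
      intro u v huv hu
      by_cases huR : u ∈ R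
      · exact hc.terminal u huR v huv ▸ hu
      · rcases hu with rfl | hu | hu
        · exact absurd hs huR
        · exact absurd hu.1 huR
        · exact Or.inr (Or.inr ⟨hcR u v huv huR, huv ▸ hu.2⟩)
    have hAB : IsBicut R c A B := by
      refine ⟨fun v hv hv' => hv'.1 hv, fun v hv => ?_, hAsat, fun u v huv hu => ?_⟩
      · by_cases hvA : v ∈ A
        · exact Or.inl hvA
        · exact Or.inr ⟨hvA, fun h => h.1 hv⟩
      · refine ⟨fun hv => hu.1 (hAsat v u huv.symm hv), fun hv => hu.2 ?_⟩
        exact ⟨hcR v u huv.symm hv.1, huv ▸ hv.2⟩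
    have htB : t ∈ B := by
      refine ⟨?_, fun h => h.1 ht⟩
      rintro (h | ⟨-, e, he, hte⟩ | h)
      · exact hst h.symm
      · exact hS he ⟨e, hte, rfl⟩
      · exact h.1 ht
    refine (hcut A B hAB (Or.inl rfl) htB).trans ?_
    have hsub : Sum.inl '' (c '' (A ∪ B)ᶜ) ∪ Sum.inr '' crossEdges H A B ⊆ Z := by
      rintro _ (⟨_, ⟨v, hv, rfl⟩, rfl⟩ | ⟨_, ⟨he, u, hu, v, hv, rfl⟩, rfl⟩)
      · have h1 : v ∉ A := fun h => hv (Or.inl h)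
        by_contra h2
        exact hv (Or.inr ⟨h1, fun h => h2 h.2⟩)
      · refine ⟨fun heS => ?_, ?_⟩
        · by_cases hvR : v ∈ R
          · exact hv.1 (Or.inr (Or.inl ⟨hvR, _, heS, Sym2.mem_mk_right u v⟩))
          · refine hv.2 ⟨hvR, fun h => hv.1 (Or.inr (Or.inr ⟨hvR, h⟩)), Or.inr ⟨_, heS, ?_⟩⟩
            exact ⟨v, Sym2.mem_mk_right u v, hvR, rfl⟩
        · rcases hu with rfl | ⟨huR, e, he', hue⟩ | ⟨huR, hu⟩
          · exact Or.inl ⟨_, he, Sym2.mem_mk_left u v, rfl⟩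
          · exact Or.inr ⟨_, he', he, u, hue, Sym2.mem_mk_left u v, huR⟩
          · exact Or.inr ⟨_, hu, he, u, Sym2.mem_mk_left u v, huR, rfl⟩
    refine le_trans (le_of_eq ?_) (Set.ncard_le_ncard hsub (Set.toFinite _))
    rw [Set.ncard_union_eq _ (Set.toFinite _) (Set.toFinite _),
      Set.ncard_image_of_injective _ Sum.inl_injective,
      Set.ncard_image_of_injective _ Sum.inr_injective, cutValue]
    rw [Set.disjoint_left]
    rintro _ ⟨a, -, rfl⟩ ⟨b, -, h⟩
    cases h)
  let ok : Fin n → V → Prop := fun i v => v ∈ R ∨ .inl (c v) ∈ P i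
  let K : Fin n → SimpleGraph V := fun i =>
    { Adj := fun u v => H.Adj u v ∧ ok i u ∧ ok i v ∧ (.inr s(u, v) ∈ P i ∨ c u = c v)
      symm := ⟨fun u v h => ⟨h.1.symm, h.2.2.1, h.2.1, by
        rw [Sym2.eq_swap]; exact h.2.2.2.imp_right Eq.symm⟩⟩
      loopless := ⟨fun _ h => h.1.ne rfl⟩ }
  have hPd' : ∀ i j, i ≠ j → ∀ a, a ∈ P i → a ∉ P j := fun i j hij _ h =>
    Set.disjoint_left.1 (hPd i j hij) h
  have hfib : ∀ i u v, .inl (c u) ∈ P i → u ∉ R → c u = c v → (K i).Reachable u v :=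
    fun i u v hu _ huv => hc.reachable huv fun a b hab ha hb =>
      ⟨hab, Or.inr (ha ▸ hu), Or.inr (hb ▸ hu), Or.inr (ha.trans hb.symm)⟩
  have hreach : ∀ i, (K i).Reachable s t := by
    intro i
    obtain ⟨_, ⟨⟨e₀, he₀, hse₀, rfl⟩, hx⟩, _, ⟨⟨e₁, hte₁, rfl⟩, hy⟩, hxy⟩ := hP i
    have hstep : ∀ e ∈ H.edgeSet, .inr e ∈ P i → ∀ u ∈ e, ok i u → (K i).Reachable s u →
        ∀ v ∈ e, ok i v → (K i).Reachable s v := by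
      intro e he heP u hu huo hsu v hv hvo
      by_cases huv : u = v
      · exact huv ▸ hsu
      have hev : e = s(u, v) := ((Sym2.mem_and_mem_iff huv).1 ⟨hu, hv⟩)
      subst hev
      exact hsu.trans (Adj.reachable ⟨he, huo, hvo, Or.inl heP⟩)
    have hall : ∀ z, Relation.ReflTransGen (fun a b => r a b ∧ b ∈ P i) (.inr e₀) z →
        z ∈ P i ∧ (∀ l, z = .inl l → ∀ v, v ∉ R → c v = l → (K i).Reachable s v) ∧
          ∀ e, z = .inr e → e ∈ H.edgeSet ∧ ∃ u ∈ e, ok i u ∧ (K i).Reachable s u := by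
      intro z hz
      induction hz with
      | refl =>
        refine ⟨hx, ?_, fun e he => ?_⟩
        · rintro l ⟨⟩
        obtain rfl := Sum.inr_injective he
        exact ⟨he₀, s, hse₀, Or.inl hs, .rfl⟩
      | @tail a b _ hab ih =>
        obtain ⟨haP, ih1, ih2⟩ := ih
        obtain ⟨hr, hbP⟩ := hab
        refine ⟨hbP, ?_, ?_⟩
        · rintro l rfl v hv rfl
          rcases a with l' | e
          · exact hr.elim
          · obtain ⟨u, hu, huR, huv⟩ := hr
            obtain ⟨heH, w, hw, hwo, hsw⟩ := ih2 e rfl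
            have huP : .inl (c u) ∈ P i := huv ▸ hbP
            exact (hstep e heH haP w hw hwo hsw u hu (Or.inr huP)).trans
              (hfib i u v huP huR huv)
        · rintro e rfl
          rcases a with l | e'
          · obtain ⟨heH, u, hu, huR, rfl⟩ := hr
            exact ⟨heH, u, hu, Or.inr haP, ih1 _ rfl u huR rfl⟩
          · obtain ⟨heH, u, hu, hu', huR⟩ := hr
            obtain ⟨heH', w, hw, hwo, hsw⟩ := ih2 e' rfl
            exact ⟨heH, u, hu', Or.inl huR, hstep e' heH' haP w hw hwo hsw u hu (Or.inl huR)⟩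
    obtain ⟨-, -, h⟩ := hall _ hxy
    obtain ⟨heH, u, hu, huo, hsu⟩ := h e₁ rfl
    exact hstep e₁ heH hy u hu huo hsu t hte₁ (Or.inl ht)
  obtain ⟨Q, hQ, hQe, hQv⟩ := exists_paths_of_reachable (H := H) hst K
    (fun i u v h => h.1) hreach (by
      intro i j hij u v hi hj
      by_cases huv : c u = c v
      · have huR : u ∉ R := fun h => hi.1.ne (hc.terminal u h v huv)
        exact hPd' i j hij _ (hi.2.1.resolve_left huR) (hj.2.1.resolve_left huR)
      · exact hPd' i j hij _ (hi.2.2.2.resolve_right huv) (hj.2.2.2.resolve_right huv))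
  refine ⟨Q, hQ, hQe, fun i j hij u hu v hv huv => ?_⟩
  by_contra huR
  obtain ⟨_, hu'⟩ := hQv i u hu
  obtain ⟨_, hv'⟩ := hQv j v hv
  have h1 := hu'.2.1.resolve_left huR
  have h2 := hv'.2.1.resolve_left (hcR u v huv huR)
  exact hPd' i j hij _ h1 (huv ▸ h2)

lemma IsContraction.lcFeasible [Finite V] {H : SimpleGraph V} {R : Set V} {c : V → V} {d : V → V → ℕ}
    (hc : IsContraction H R c) (hcut : CutFeasible H R c d) : LCFeasible H R d := by
  intro s hs t ht hst
  obtain ⟨P, hP, hPe, hPv⟩ := hc.exists_paths hs ht hst (hcut s hs t ht)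
  exact (le_elemConn_iff hst).2
    ⟨P, hP, fun i j hij => ⟨hPe i j hij, fun v hi hj => hPv i j hij v hi v hj rfl⟩⟩

lemma LCFeasible.cutFeasible [Finite V] {H : SimpleGraph V} {R : Set V} {d : V → V → ℕ}
    (h : LCFeasible H R d) : CutFeasible H R id d := by
  intro s hs t ht A B hAB hsA htB
  have hst : s ≠ t := fun h => hAB.disj s hsA (h ▸ htB)
  obtain ⟨P, -, hP⟩ := (le_elemConn_iff hst).1 (h s hs t ht hst)
  have hex : ∀ i, ∃ a : V ⊕ Sym2 V, a ∈ Sum.inl '' (id '' (A ∪ B)ᶜ) ∪ Sum.inr '' crossEdges H A B ∧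
      (∀ v, a = .inl v → v ∈ (P i).support) ∧ ∀ e, a = .inr e → e ∈ (P i).edges := by
    intro i
    obtain ⟨δ, hδ, h1, h2⟩ := (P i).exists_boundary_dart A hsA (fun h => hAB.disj t h htB)
    by_cases hB : δ.snd ∈ B
    · refine ⟨.inr δ.edge, Or.inr ⟨_, ⟨δ.edge_mem, δ.fst, h1, δ.snd, hB, rfl⟩, rfl⟩, ?_, ?_⟩
      · rintro v ⟨⟩
      · rintro _ ⟨⟩
        exact List.mem_map_of_mem hδ
    · refine ⟨.inl δ.snd, Or.inl ⟨_, ⟨_, fun h => h.elim h2 hB, rfl⟩, rfl⟩, ?_, ?_⟩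
      · rintro _ ⟨⟩
        exact (P i).dart_snd_mem_support_of_mem_darts hδ
      · rintro e ⟨⟩
  choose a ha hav hae using hex
  have hinj : Function.Injective a := by
    intro i j hij
    by_contra hne
    obtain ⟨h1, h2⟩ := hP i j hne
    rcases hai : a i with v | e
    · have hv := h2 v (hav i v hai) (hav j v (hij ▸ hai))
      rcases ha i with ⟨_, ⟨w, hw, rfl⟩, hw'⟩ | ⟨e, -, he⟩
      · obtain rfl := Sum.inl_injective (hw'.trans hai)
        exact hw (hAB.cover _ hv)
      · cases he.trans hai
    · exact h1 e (hae i e hai) (hae j e (hij ▸ hai))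
  have hcard : (Set.range a).ncard = d s t := by
    rw [← Set.image_univ, Set.ncard_image_of_injective _ hinj, Set.ncard_univ, Nat.card_fin]
  rw [← hcard, cutValue]
  refine (Set.ncard_le_ncard (Set.range_subset_iff.2 ha) (Set.toFinite _)).trans ?_
  refine (Set.ncard_union_le _ _).trans ?_
  rw [Set.ncard_image_of_injective _ Sum.inl_injective,
    Set.ncard_image_of_injective _ Sum.inr_injective]

lemma IsBicut.symm {R : Set V} {c : V → V} {A B : Set V} (h : IsBicut R c A B) :
    IsBicut R c B A :=
  ⟨fun v hB hA => h.disj v hA hB, fun v hv => (h.cover v hv).symm, h.right, h.left⟩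

lemma IsBicut.inter_union {R : Set V} {c : V → V} {A B A' B' : Set V} (h : IsBicut R c A B)
    (h' : IsBicut R c A' B') : IsBicut R c (A ∩ A') (B ∪ B') where
  disj v hA hB := hB.elim (h.disj v hA.1) (h'.disj v hA.2)
  cover v hv := by
    have := h.cover v hv
    have := h'.cover v hv
    simp only [Set.mem_inter_iff, Set.mem_union]
    tauto
  left u v huv hu := ⟨h.left u v huv hu.1, h'.left u v huv hu.2⟩
  right u v huv hu := hu.imp (h.right u v huv) (h'.right u v huv)

lemma crossEdges_comm (H : SimpleGraph V) (A B : Set V) : crossEdges H A B = crossEdges H B A := by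
  ext e
  constructor <;>
  · rintro ⟨he, u, hu, v, hv, rfl⟩
    exact ⟨he, v, hv, u, hu, Sym2.eq_swap⟩

lemma cutValue_comm (H : SimpleGraph V) (c : V → V) (A B : Set V) :
    cutValue H c A B = cutValue H c B A := by
  rw [cutValue, cutValue, Set.union_comm, crossEdges_comm]

lemma CutFeasible.le_of_separates {H : SimpleGraph V} {R : Set V} {c : V → V} {d : V → V → ℕ}
    (h : CutFeasible H R c d) {s t : V} (hs : s ∈ R) (ht : t ∈ R) {A B : Set V}
    (hAB : IsBicut R c A B) (hst : s ∈ A ∧ t ∈ B ∨ s ∈ B ∧ t ∈ A) :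
    d s t ≤ cutValue H c A B := by
  rcases hst with hst | hst
  · exact h s hs t ht A B hAB hst.1 hst.2
  · rw [cutValue_comm]
    exact h s hs t ht B A hAB.symm hst.1 hst.2

/-- Submodularity of cut values, with a gain of one for an edge that crosses one cut and lies
on the boundary of the other. -/
lemma cutValue_submodular [Finite V] {H : SimpleGraph V} {R : Set V} {c : V → V} {A B A' B' : Set V}
    (h : IsBicut R c A B) (h' : IsBicut R c A' B') {e : Sym2 V} (he : e ∈ crossEdges H A B)
    (he' : ∀ v ∈ e, v ∉ A' ∧ v ∉ B') :
    cutValue H c (A ∩ A') (B ∪ B') + cutValue H c (A ∪ A') (B ∩ B') + 1 ≤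
      cutValue H c A B + cutValue H c A' B' := by
  have key : ∀ {β : Type _} [Finite β] (E₁ E₂ F₁ F₂ : Set β), E₁ ∪ E₂ ⊆ F₁ ∪ F₂ →
      E₁ ∩ E₂ ⊆ F₁ ∩ F₂ → E₁.ncard + E₂.ncard ≤ F₁.ncard + F₂.ncard := by
    intro β _ E₁ E₂ F₁ F₂ h1 h2
    rw [← Set.ncard_union_add_ncard_inter E₁ E₂, ← Set.ncard_union_add_ncard_inter F₁ F₂]
    exact add_le_add (Set.ncard_le_ncard h1 (Set.toFinite _))
      (Set.ncard_le_ncard h2 (Set.toFinite _))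
  have hl := key (c '' (A ∩ A' ∪ (B ∪ B'))ᶜ) (c '' (A ∪ A' ∪ B ∩ B')ᶜ) (c '' (A ∪ B)ᶜ)
    (c '' (A' ∪ B')ᶜ) (by
      rw [← Set.image_union, ← Set.image_union]
      refine Set.image_mono fun v hv => ?_
      have := h.disj v
      have := h'.disj v
      simp only [Set.mem_union, Set.mem_compl_iff, Set.mem_inter_iff] at hv ⊢
      tauto) (by
      rintro _ ⟨⟨v, hv, rfl⟩, ⟨w, hw, hwv⟩⟩
      have := h.left v w hwv.symm
      have := h.right v w hwv.symm
      have := h'.left v w hwv.symm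
      have := h'.right v w hwv.symm
      simp only [Set.mem_union, Set.mem_compl_iff, Set.mem_inter_iff] at hv hw
      refine ⟨⟨v, ?_, rfl⟩, ⟨v, ?_, rfl⟩⟩ <;>
      · simp only [Set.mem_union, Set.mem_compl_iff]
        tauto)
  have hE := key (crossEdges H (A ∩ A') (B ∪ B')) (crossEdges H (A ∪ A') (B ∩ B'))
    (crossEdges H A B \ {e}) (crossEdges H A' B') (by
      rintro f (⟨hf, u, hu, v, hv, rfl⟩ | ⟨hf, u, hu, v, hv, rfl⟩)
      · have hne : s(u, v) ≠ e := fun h => (he' u (h ▸ Sym2.mem_mk_left u v)).1 hu.2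
        exact hv.imp (fun hv => ⟨⟨hf, u, hu.1, v, hv, rfl⟩, hne⟩)
          (fun hv => ⟨hf, u, hu.2, v, hv, rfl⟩)
      · have hne : s(u, v) ≠ e := fun h => (he' v (h ▸ Sym2.mem_mk_right u v)).2 hv.2
        exact hu.imp (fun hu => ⟨⟨hf, u, hu, v, hv.1, rfl⟩, hne⟩)
          (fun hu => ⟨hf, u, hu, v, hv.2, rfl⟩)) (by
      rintro f ⟨⟨hf, u, hu, v, hv, rfl⟩, ⟨-, u', hu', v', hv', huv⟩⟩
      have hne : s(u, v) ≠ e := fun h => (he' u (h ▸ Sym2.mem_mk_left u v)).1 hu.2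
      rcases Sym2.eq_iff.1 huv with ⟨rfl, rfl⟩ | ⟨rfl, rfl⟩
      · exact ⟨⟨⟨hf, u, hu.1, v, hv'.1, rfl⟩, hne⟩, ⟨hf, u, hu.2, v, hv'.2, rfl⟩⟩
      · exact absurd hv'.1 (h.disj u hu.1))
  have := Set.ncard_sdiff_singleton_add_one he (Set.toFinite _)
  simp only [cutValue]
  omega

/-- Two cuts whose values are at most the demands they separate cannot be such that some edge
crosses the first and lies on the boundary of the second. -/
lemma CutFeasible.not_tight [Finite V] {H : SimpleGraph V} {R : Set V} {c : V → V} {d : V → V → ℕ}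
    (hcut : CutFeasible H R c d) {A B A' B' : Set V}
    (h : IsBicut R c A B) (h' : IsBicut R c A' B') {e : Sym2 V} (he : e ∈ crossEdges H A B)
    (he' : ∀ v ∈ e, v ∉ A' ∧ v ∉ B') {s t x y : V} (hs : s ∈ R) (ht : t ∈ R) (hx : x ∈ R)
    (hy : y ∈ R) (hsA : s ∈ A) (htB : t ∈ B) (hxA : x ∈ A') (hyB : y ∈ B')
    (hle : cutValue H c A B ≤ d s t) : d x y < cutValue H c A' B' := by
  by_contra! hle'
  have h1 := h.inter_union h'
  have h2 := (h.symm.inter_union h'.symm).symm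
  have h3 := h.inter_union h'.symm
  have h4 := (h.symm.inter_union h').symm
  have s1 := cutValue_submodular h h' he he'
  have s2 := cutValue_submodular h h'.symm he fun v hv => (he' v hv).symm
  rw [cutValue_comm H c B' A'] at s2
  have k1 := hcut.le_of_separates hs ht h1
  have k2 := hcut.le_of_separates hs ht h2
  have k3 := hcut.le_of_separates hs ht h3
  have k4 := hcut.le_of_separates hs ht h4
  have l1 := hcut.le_of_separates hx hy h1
  have l2 := hcut.le_of_separates hx hy h2
  have l3 := hcut.le_of_separates hx hy h3
  have l4 := hcut.le_of_separates hx hy h4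
  simp only [Set.mem_inter_iff, Set.mem_union, hsA, htB, hxA, hyB] at k1 k2 k3 k4 l1 l2 l3 l4
  rcases h'.cover s hs with hs' | hs' <;> rcases h'.cover t ht with ht' | ht' <;>
  rcases h.cover x hx with hx' | hx' <;> rcases h.cover y hy with hy' | hy' <;>
  simp only [hs', ht', hx', hy', true_and, and_true, true_or, or_true, and_self, forall_const]
    at k1 k2 k3 k4 l1 l2 l3 l4 <;> omega

lemma isContraction_id (H : SimpleGraph V) (R : Set V) : IsContraction H R id where
  terminal _ _ _ h := h
  conn u v h := by
    obtain rfl : u = v := h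
    exact .rfl

/-- In a minimal solution, contracting an edge between Steiner vertices preserves the cut
condition. -/
lemma IsContraction.merge [Finite V] [DecidableEq V] {H : SimpleGraph V} {R : Set V} {c : V → V}
    {d : V → V → ℕ} (hc : IsContraction H R c) (hcut : CutFeasible H R c d) {p q : V}
    (hpq : H.Adj p q) (hp : p ∉ R) (hq : q ∉ R) (hne : c p ≠ c q)
    (hmin : ¬ LCFeasible (H.deleteEdges {s(p, q)}) R d) :
    IsContraction H R (fun v => if c v = c q then c p else c v) ∧
      CutFeasible H R (fun v => if c v = c q then c p else c v) d := by
  set c' : V → V := fun v => if c v = c q then c p else c v with hc'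
  have hcc' : ∀ u v, c u = c v → c' u = c' v := fun u v h => by simp only [hc', h]
  have hcp : c' p = c p := if_neg hne
  have hcq : c' q = c p := if_pos rfl
  have hcases : ∀ u v, c' u = c' v → c u = c v ∨ (c u = c p ∧ c v = c q) ∨
      (c u = c q ∧ c v = c p) := by
    intro u v h
    simp only [hc'] at h
    split_ifs at h with h1 h2 h2
    · exact Or.inl (h1.trans h2.symm)
    · exact Or.inr (Or.inr ⟨h1, h.symm⟩)
    · exact Or.inr (Or.inl ⟨h, h2⟩)
    · exact Or.inl h
  have hcR : ∀ u v, c u = c v → u ∉ R → v ∉ R := fun u v huv hu hv =>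
    hu (hc.terminal v hv u huv.symm ▸ hv)
  have hmono : ∀ u v, c u = c v → (fibreGraph H c').Reachable u v := fun u v huv =>
    (hc.conn u v huv).mono fun a b (hab : H.Adj a b ∧ c a = c b) => ⟨hab.1, hcc' a b hab.2⟩
  have hpq' : (fibreGraph H c').Reachable p q := Adj.reachable ⟨hpq, hcp.trans hcq.symm⟩
  refine ⟨⟨fun u hu v huv => ?_, fun u v huv => ?_⟩, ?_⟩
  · rcases hcases u v huv with h | ⟨h, -⟩ | ⟨h, -⟩
    · exact hc.terminal u hu v h
    · exact absurd hu (hcR p u h.symm hp)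
    · exact absurd hu (hcR q u h.symm hq)
  · rcases hcases u v huv with h | ⟨h, h'⟩ | ⟨h, h'⟩
    · exact hmono u v h
    · exact (hmono u p h).trans (hpq'.trans (hmono q v h'.symm))
    · exact (hmono u q h).trans (hpq'.symm.trans (hmono p v h'.symm))
  intro x hx y hy A' B' hAB' hxA hyB
  have hAB'' : IsBicut R c A' B' := ⟨hAB'.disj, hAB'.cover, fun u v h => hAB'.left u v (hcc' u v h),
    fun u v h => hAB'.right u v (hcc' u v h)⟩
  have hle := hcut x hx y hy A' B' hAB'' hxA hyB
  have hdel : IsContraction (H.deleteEdges {s(p, q)}) R c := by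
    refine ⟨hc.terminal, fun u v huv => (hc.conn u v huv).mono
      fun a b (hab : H.Adj a b ∧ c a = c b) => ⟨?_, hab.2⟩⟩
    rw [deleteEdges_adj]
    refine ⟨hab.1, fun h => hne ?_⟩
    rcases Sym2.eq_iff.1 (Set.mem_singleton_iff.1 h) with ⟨rfl, rfl⟩ | ⟨rfl, rfl⟩
    · exact hab.2
    · exact hab.2.symm
  have hncut : ¬ CutFeasible (H.deleteEdges {s(p, q)}) R c d := fun h => hmin (hdel.lcFeasible h)
  simp only [CutFeasible, not_forall, not_le] at hncut
  obtain ⟨s, hs, t, ht, A, B, hAB, hsA, htB, hlt⟩ := hncut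
  have hst := hcut s hs t ht A B hAB hsA htB
  have hcross : crossEdges (H.deleteEdges {s(p, q)}) A B = crossEdges H A B \ {s(p, q)} := by
    rw [crossEdges, edgeSet_deleteEdges]
    ext e
    exact ⟨fun h => ⟨⟨h.1.1, h.2⟩, h.1.2⟩, fun h => ⟨⟨h.1.1, h.2⟩, h.1.2⟩⟩
  rw [cutValue, hcross] at hlt
  by_cases hpqA : s(p, q) ∈ crossEdges H A B
  swap
  · rw [Set.sdiff_singleton_eq_self hpqA] at hlt
    exact absurd hlt (not_lt.2 hst)
  have hcard := Set.ncard_sdiff_singleton_add_one hpqA (Set.toFinite _)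
  have htight : cutValue H c A B ≤ d s t := by
    rw [cutValue]
    omega
  have himg : ∀ v, c v ≠ c q → c' v = c v := fun v hv => if_neg hv
  by_cases hqb : q ∈ A' ∨ q ∈ B'
  · refine hle.trans (le_of_eq ?_)
    have : c '' (A' ∪ B')ᶜ = c' '' (A' ∪ B')ᶜ := by
      refine Set.image_congr fun v hv => (himg v fun h => hv ?_).symm
      exact hqb.imp (hAB''.left q v h.symm) (hAB''.right q v h.symm)
    rw [cutValue, cutValue, this]
  · have hpb : ¬ (p ∈ A' ∨ p ∈ B') := fun h => hqb <|
      h.imp (hAB'.left p q (hcp.trans hcq.symm)) (hAB'.right p q (hcp.trans hcq.symm))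
    have hlt' := hcut.not_tight hAB hAB'' hpqA (by
      intro v hv
      rcases Sym2.mem_iff.1 hv with rfl | rfl <;> tauto) hs ht hx hy hsA htB hxA hyB htight
    have hsub : c '' (A' ∪ B')ᶜ ⊆ insert (c q) (c' '' (A' ∪ B')ᶜ) := by
      rintro _ ⟨v, hv, rfl⟩
      by_cases h : c v = c q
      · exact Or.inl h
      · exact Or.inr ⟨v, hv, himg v h⟩
    have := (Set.ncard_le_ncard hsub (Set.toFinite _)).trans (Set.ncard_insert_le _ _)
    rw [cutValue] at hlt' ⊢
    omega

/-- In a minimal solution, contracting all edges between Steiner vertices preserves the cut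
condition. -/
lemma exists_isContraction [Finite V] {H : SimpleGraph V} {R : Set V} {d : V → V → ℕ}
    (hfeas : LCFeasible H R d)
    (hmin : ∀ e ∈ H.edgeSet, ¬ LCFeasible (H.deleteEdges {e}) R d) :
    ∃ c : V → V, IsContraction H R c ∧ CutFeasible H R c d ∧
      ∀ p q, H.Adj p q → p ∉ R → q ∉ R → c p = c q := by
  classical
  obtain ⟨c, ⟨hc, hcut⟩, hcmin⟩ := exists_minimalFor_of_wellFoundedLT
    (fun c : V → V => IsContraction H R c ∧ CutFeasible H R c d) (fun c => (Set.range c).ncard)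
    ⟨id, isContraction_id H R, hfeas.cutFeasible⟩
  refine ⟨c, hc, hcut, fun p q hpq hp hq => ?_⟩
  by_contra hne
  have hlt : (Set.range fun v => if c v = c q then c p else c v).ncard < (Set.range c).ncard := by
    refine Set.ncard_lt_ncard (ssubset_of_subset_of_ne ?_ fun h => ?_) (Set.toFinite _)
    · rintro _ ⟨v, rfl⟩
      dsimp only
      split_ifs
      exacts [⟨p, rfl⟩, ⟨v, rfl⟩]
    · obtain ⟨v, hv⟩ := h.symm ▸ Set.mem_range_self (f := c) q
      dsimp only at hv
      split_ifs at hv with h'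
      exacts [hne hv, h' hv]
  exact absurd (hcmin (hc.merge hcut hpq hp hq hne (hmin _ hpq)) hlt.le) (not_le.2 hlt)

lemma SimpleGraph.Subgraph.isTree_coe {H : SimpleGraph V} (T : H.Subgraph) (hne : T.verts.Nonempty)
    (hconn : ∀ u ∈ T.verts, ∀ v ∈ T.verts, T.spanningCoe.Reachable u v)
    (hbridge : ∀ u v, T.Adj u v → T.spanningCoe.IsBridge s(u, v)) : T.coe.IsTree := by
  have hlift : ∀ u v (_ : T.spanningCoe.Walk u v) (hu : u ∈ T.verts) (hv : v ∈ T.verts),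
      T.coe.Reachable ⟨u, hu⟩ ⟨v, hv⟩ := by
    intro u v w
    induction w with
    | nil => exact fun _ _ => .rfl
    | @cons a b _ hab _ ih =>
      intro ha hv
      have hb : b ∈ T.verts := T.edge_vert (T.adj_symm hab)
      have hab' : T.coe.Adj ⟨a, ha⟩ ⟨b, hb⟩ := hab
      exact hab'.reachable.trans (ih hb hv)
  have := hne.to_subtype
  refine ⟨⟨fun u v => ?_⟩, ?_⟩
  · obtain ⟨w⟩ := hconn u u.2 v v.2
    exact hlift u v w u.2 v.2
  · have hac : T.spanningCoe.IsAcyclic := by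
      rw [isAcyclic_iff_forall_adj_isBridge]
      exact fun u v => hbridge u v
    exact hac.comap ⟨Subtype.val, fun h => h⟩ Subtype.val_injective

/-- The subgraph formed by all edges incident to a Steiner vertex in the fibre of `l`. -/
def steinerSubgraph (H : SimpleGraph V) (R : Set V) (c : V → V) (l : V) : H.Subgraph where
  verts := {v | ∃ u, u ∉ R ∧ c u = l ∧ (u = v ∨ H.Adj u v)}
  Adj u v := H.Adj u v ∧ ((u ∉ R ∧ c u = l) ∨ (v ∉ R ∧ c v = l))
  adj_sub h := h.1
  edge_vert := by
    rintro u v ⟨h, hu | hv⟩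
    · exact ⟨u, hu.1, hu.2, Or.inl rfl⟩
    · exact ⟨v, hv.1, hv.2, Or.inr h.symm⟩
  symm := ⟨fun _ _ h => ⟨h.1.symm, h.2.symm⟩⟩

/-- The subgraph consisting of a single edge. -/
def edgeSubgraph (H : SimpleGraph V) (e : Sym2 V) (he : e ∈ H.edgeSet) : H.Subgraph where
  verts := {v | v ∈ e}
  Adj u v := s(u, v) = e
  adj_sub h := by
    subst h
    exact he
  edge_vert := by
    rintro u v rfl
    exact Sym2.mem_mk_left u v
  symm := ⟨fun _ _ h => Sym2.eq_swap.trans h⟩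

lemma edgeSubgraph_isTree {H : SimpleGraph V} {e : Sym2 V} (he : e ∈ H.edgeSet) :
    (edgeSubgraph H e he).coe.IsTree := by
  refine Subgraph.isTree_coe _ ?_ ?_ ?_
  · exact ⟨_, e.out_fst_mem⟩
  · intro u hu v hv
    by_cases huv : u = v
    · exact huv ▸ .rfl
    · exact Adj.reachable ((Sym2.mem_and_mem_iff huv).1 ⟨hu, hv⟩).symm
  · intro u v huv
    change s(u, v) = e at huv
    subst huv
    rw [isBridge_iff]
    have : (edgeSubgraph H s(u, v) he).spanningCoe.deleteEdges {s(u, v)} = ⊥ := by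
      ext a b
      rw [deleteEdges_adj]
      exact iff_of_false (fun h => h.2 h.1) id
    rw [this, reachable_bot]
    exact H.ne_of_adj he

/-- A connected Steiner vertex of a minimal solution is not a leaf. -/
lemma not_leaf_of_minimal [Finite V] {H : SimpleGraph V} {R : Set V} {d : V → V → ℕ}
    (hfeas : LCFeasible H R d) {v w : V} (hvw : H.Adj v w)
    (hmin : ¬ LCFeasible (H.deleteEdges {s(v, w)}) R d) (hv : v ∉ R) :
    ∃ u, H.Adj v u ∧ u ≠ w := by
  classical
  by_contra! hleaf
  refine hmin fun s hs t ht hst => (le_elemConn_iff hst).2 ?_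
  obtain ⟨P, -, hP⟩ := (le_elemConn_iff hst).1 (hfeas s hs t ht hst)
  let K : Fin (d s t) → SimpleGraph V := fun i => fromEdgeSet ({e | e ∈ (P i).edges} \ {s(v, w)})
  have hKP : ∀ i a b, (K i).Adj a b → s(a, b) ∈ (P i).edges := fun i a b h =>
    ((fromEdgeSet_adj _).1 h).1.1
  refine ElemDisjPaths.exists_of_reachable hst K ?_ ?_ ?_ ?_
  · intro i a b hab
    rw [deleteEdges_adj]
    exact ⟨(P i).adj_of_mem_edges (hKP i a b hab), ((fromEdgeSet_adj _).1 hab).1.2⟩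
  · intro i
    have h := (P i).reachable_of_forall_mem_edges (K' := K i) (fun x => if x = v then w else x) (by
      intro a b hab
      have hHab := (P i).adj_of_mem_edges hab
      split_ifs with h1 h2 h2
      · exact .rfl
      · subst h1
        rw [hleaf b hHab]
      · subst h2
        rw [hleaf a hHab.symm]
      · refine Adj.reachable ((fromEdgeSet_adj _).2 ⟨⟨hab, fun h => ?_⟩, hHab.ne⟩)
        have : v ∈ s(a, b) := (Set.mem_singleton_iff.1 h) ▸ Sym2.mem_mk_left v w
        rcases Sym2.mem_iff.1 this with rfl | rfl
        exacts [h1 rfl, h2 rfl])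
    rwa [if_neg fun h : s = v => hv (h ▸ hs), if_neg fun h : t = v => hv (h ▸ ht)] at h
  · exact fun i j hij a b ha hb => (hP i j hij).1 _ (hKP i a b ha) (hKP j a b hb)
  · exact fun i j hij a b b' hb hb' => (hP i j hij).2 a
      ((P i).fst_mem_support_of_mem_edges (hKP i a b hb))
      ((P j).fst_mem_support_of_mem_edges (hKP j a b' hb'))

/-- In a minimal solution, every edge incident to a Steiner component is a bridge of the subgraph
formed by these edges. -/
lemma steinerSubgraph_isBridge [Finite V] {H : SimpleGraph V} {R : Set V} {c : V → V}
    {d : V → V → ℕ} (hc : IsContraction H R c) (hcut : CutFeasible H R c d)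
    (hconst : ∀ p q, H.Adj p q → p ∉ R → q ∉ R → c p = c q) {l a b : V}
    (hab : (steinerSubgraph H R c l).Adj a b)
    (hmin : ¬ LCFeasible (H.deleteEdges {s(a, b)}) R d) :
    (steinerSubgraph H R c l).spanningCoe.IsBridge s(a, b) := by
  rw [isBridge_iff]
  intro hreach
  refine hmin fun s hs t ht hst => (le_elemConn_iff hst).2 ?_
  obtain ⟨P, -, hPe, hPv⟩ := hc.exists_paths hs ht hst (hcut s hs t ht)
  set T := steinerSubgraph H R c l with hT
  let touches : Fin (d s t) → Prop := fun i => ∃ v ∈ (P i).support, v ∉ R ∧ c v = l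
  have htouches : ∀ i j, i ≠ j → touches i → ¬ touches j := by
    rintro i j hij ⟨u, hu, huR, hul⟩ ⟨v, hv, -, hvl⟩
    exact huR (hPv i j hij u hu v hv (hul.trans hvl.symm))
  have htouch : ∀ i u v, T.Adj u v → s(u, v) ∈ (P i).edges → touches i := by
    rintro i u v ⟨-, h | h⟩ he
    · exact ⟨u, (P i).fst_mem_support_of_mem_edges he, h⟩
    · exact ⟨v, (P i).snd_mem_support_of_mem_edges he, h⟩
  let K : Fin (d s t) → SimpleGraph V := fun i =>
    fromEdgeSet (({e | e ∈ (P i).edges} ∪ {e | touches i ∧ e ∈ T.edgeSet}) \ {s(a, b)})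
  have hK : ∀ i u v, (K i).Adj u v →
      (s(u, v) ∈ (P i).edges ∨ touches i ∧ T.Adj u v) ∧ s(u, v) ≠ s(a, b) := fun i u v h =>
    ((fromEdgeSet_adj _).1 h).1
  have hKv : ∀ i v u, (K i).Adj v u → v ∉ R → v ∈ (P i).support ∨ touches i ∧ c v = l := by
    intro i v u h hv
    rcases (hK i v u h).1 with h | ⟨hi, h, hvl | hul⟩
    · exact Or.inl ((P i).fst_mem_support_of_mem_edges h)
    · exact Or.inr ⟨hi, hvl.2⟩
    · exact Or.inr ⟨hi, (hconst v u h hv hul.1).trans hul.2⟩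
  refine ElemDisjPaths.exists_of_reachable hst K ?_ ?_ ?_ ?_
  · intro i u v huv
    rw [deleteEdges_adj]
    obtain ⟨h | h, hne⟩ := hK i u v huv
    · exact ⟨(P i).adj_of_mem_edges h, hne⟩
    · exact ⟨h.2.1, hne⟩
  · intro i
    refine (P i).reachable_of_forall_mem_edges id fun u v huv => ?_
    by_cases hne : s(u, v) = s(a, b)
    · have hi := htouch i a b hab (hne ▸ huv)
      have hle : T.spanningCoe.deleteEdges {s(a, b)} ≤ K i := by
        intro x y hxy
        rw [deleteEdges_adj] at hxy
        exact (fromEdgeSet_adj _).2 ⟨⟨Or.inr ⟨hi, hxy.1⟩, hxy.2⟩, hxy.1.ne⟩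
      rcases Sym2.eq_iff.1 hne with ⟨rfl, rfl⟩ | ⟨rfl, rfl⟩
      · exact hreach.mono hle
      · exact (hreach.mono hle).symm
    · exact Adj.reachable
        ((fromEdgeSet_adj _).2 ⟨⟨Or.inl huv, hne⟩, ((P i).adj_of_mem_edges huv).ne⟩)
  · intro i j hij u v hi hj
    rcases (hK i u v hi).1 with h | h <;> rcases (hK j u v hj).1 with h' | h'
    · exact hPe i j hij _ h h'
    · exact htouches i j hij (htouch i u v h'.2 h) h'.1
    · exact htouches i j hij h.1 (htouch j u v h.2 h')
    · exact htouches i j hij h.1 h'.1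
  · intro i j hij v u w hu hw
    by_contra hv
    rcases hKv i v u hu hv with h | h <;> rcases hKv j v w hw hv with h' | h'
    · exact hv (hPv i j hij v h v h' rfl)
    · exact htouches i j hij ⟨v, h, hv, h'.2⟩ h'.1
    · exact htouches i j hij h.1 ⟨v, h', hv, h.2⟩
    · exact htouches i j hij h.1 h'.1

lemma steinerSubgraph_reachable {H : SimpleGraph V} {R : Set V} {c : V → V}
    (hc : IsContraction H R c) {u v : V} (hu : u ∉ R) (huv : c u = c v) {E : Set (Sym2 V)}
    (hE : ∀ e ∈ E, ∃ r ∈ e, r ∈ R) :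
    ((steinerSubgraph H R c (c u)).spanningCoe.deleteEdges E).Reachable u v := by
  have hR : ∀ a, c a = c u → a ∉ R := fun a ha haR => hu (hc.terminal a haR u ha ▸ haR)
  refine hc.reachable huv fun a b hab ha hb => ?_
  rw [deleteEdges_adj]
  refine ⟨⟨hab, Or.inl ⟨hR a ha, ha⟩⟩, fun h => ?_⟩
  obtain ⟨r, hr, hrR⟩ := hE _ h
  rcases Sym2.mem_iff.1 hr with rfl | rfl
  exacts [hR _ ha hrR, hR _ hb hrR]

lemma steinerSubgraph_isTree [Finite V] {H : SimpleGraph V} {R : Set V} {c : V → V}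
    {d : V → V → ℕ} (hc : IsContraction H R c) (hcut : CutFeasible H R c d)
    (hconst : ∀ p q, H.Adj p q → p ∉ R → q ∉ R → c p = c q)
    (hmin : ∀ e ∈ H.edgeSet, ¬ LCFeasible (H.deleteEdges {e}) R d) {v₀ : V} (hv₀ : v₀ ∉ R) :
    (steinerSubgraph H R c (c v₀)).coe.IsTree := by
  refine Subgraph.isTree_coe _ ⟨v₀, v₀, hv₀, rfl, Or.inl rfl⟩ ?_ fun u v huv =>
    steinerSubgraph_isBridge hc hcut hconst huv (hmin _ huv.1)
  have h : ∀ u ∈ (steinerSubgraph H R c (c v₀)).verts,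
      (steinerSubgraph H R c (c v₀)).spanningCoe.Reachable v₀ u := by
    rintro u ⟨w, hwR, hw, hwu⟩
    have h₀ := steinerSubgraph_reachable (H := H) hc hv₀ hw.symm (E := ∅) (by simp)
    rw [deleteEdges_empty] at h₀
    rcases hwu with rfl | hwu
    · exact h₀
    · exact h₀.trans (Adj.reachable ⟨hwu, Or.inl ⟨hwR, hw⟩⟩)
  exact fun u hu v hv => (h u hu).symm.trans (h v hv)

/-- A terminal is incident to at most one edge of a Steiner component of a minimal solution. -/
lemma steinerSubgraph_adj_unique [Finite V] {H : SimpleGraph V} {R : Set V} {c : V → V}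
    {d : V → V → ℕ} (hc : IsContraction H R c) (hcut : CutFeasible H R c d)
    (hconst : ∀ p q, H.Adj p q → p ∉ R → q ∉ R → c p = c q)
    (hmin : ∀ e ∈ H.edgeSet, ¬ LCFeasible (H.deleteEdges {e}) R d) {l v a b : V} (hv : v ∈ R)
    (ha : (steinerSubgraph H R c l).Adj v a) (hb : (steinerSubgraph H R c l).Adj v b) :
    a = b := by
  by_contra hab
  obtain ⟨haR, hal⟩ := ha.2.resolve_left fun h => h.1 hv
  obtain ⟨hbR, rfl⟩ := hb.2.resolve_left fun h => h.1 hv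
  have hbridge := steinerSubgraph_isBridge hc hcut hconst ha (hmin _ ha.1)
  rw [isBridge_iff] at hbridge
  refine hbridge (Reachable.trans (Adj.reachable ?_)
    (steinerSubgraph_reachable hc hbR hal.symm ?_))
  · rw [deleteEdges_adj]
    refine ⟨hb, fun h => hab ?_⟩
    exact (Sym2.congr_right.1 (Set.mem_singleton_iff.1 h)).symm
  · rintro e rfl
    exact ⟨v, Sym2.mem_mk_left v a, hv⟩

end ElementConnectivity

/-- Any minimal feasible LC-SNDP solution `H` decomposes into trees
`T₁, …, T_b` that pairwise share only terminals, whose leaves are terminals and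
whose internal vertices are Steiner vertices; moreover for every terminal pair
there are `d s t` element-disjoint paths in `H` such that each tree's edge set
meets the edge set of at most one of these paths. -/
theorem lc_minimal_solution_tree_partition {V : Type*} [Fintype V] [DecidableEq V]
    (G H : SimpleGraph V) (R : Set V) (d : V → V → ℕ)
    (hHG : H ≤ G)
    (hfeas : LCFeasible H R d)
    (hmin : ∀ e ∈ H.edgeSet, ¬ LCFeasible (H.deleteEdges {e}) R d) :
    ∃ (b : ℕ) (T : Fin b → H.Subgraph),
      (∀ i, ((T i).coe).IsTree) ∧
      (H.edgeSet = ⋃ i, (T i).edgeSet) ∧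
      (∀ i j, i ≠ j → ∀ v, v ∈ (T i).verts → v ∈ (T j).verts → v ∈ R) ∧
      (∀ i, ∀ v ∈ (T i).verts, ((T i).neighborSet v).ncard = 1 → v ∈ R) ∧
      (∀ i, ∀ v ∈ (T i).verts, 2 ≤ ((T i).neighborSet v).ncard → v ∉ R) ∧
      (∀ s ∈ R, ∀ t ∈ R, s ≠ t → ∃ P : Fin (d s t) → H.Walk s t,
        ElemDisjPaths H R s t (d s t) P ∧
        ∀ i : Fin b, {j | ∃ e ∈ (P j).edges, e ∈ (T i).edgeSet}.Subsingleton) := by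
  classical
  obtain ⟨c, hc, hcut, hconst⟩ := exists_isContraction hfeas hmin
  let ι := (Set.range fun v : {v // v ∉ R} => c v) ⊕ {e : H.edgeSet // ∀ v ∈ e.1, v ∈ R}
  let T : ι → H.Subgraph :=
    Sum.elim (fun l => steinerSubgraph H R c l) (fun e => edgeSubgraph H e.1 e.1.2)
  have hverts : ∀ (l v : V), v ∈ (steinerSubgraph H R c l).verts → v ∉ R → c v = l := by
    rintro l v ⟨u, huR, hul, rfl | huv⟩ hv
    · exact hul
    · exact (hconst u v huv huR hv).symm.trans hul
  let φ := Finite.equivFin ι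
  refine ⟨Nat.card ι, fun i => T (φ.symm i), ?_, ?_, ?_, ?_, ?_, ?_⟩ <;> dsimp only
  · intro i
    rcases φ.symm i with ⟨_, ⟨v, hv⟩, rfl⟩ | e
    · exact steinerSubgraph_isTree hc hcut hconst hmin hv
    · exact edgeSubgraph_isTree e.1.2
  · refine subset_antisymm (fun e he => ?_)
      (Set.iUnion_subset fun i => (T (φ.symm i)).edgeSet_subset)
    suffices h : ∃ k, e ∈ (T k).edgeSet by
      obtain ⟨k, hk⟩ := h
      exact Set.mem_iUnion.2 ⟨φ k, by simpa using hk⟩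
    by_cases hR : ∀ v ∈ e, v ∈ R
    · refine ⟨.inr ⟨⟨e, he⟩, hR⟩, ?_⟩
      induction e with
      | h u v => exact (rfl : s(u, v) = s(u, v))
    · push Not at hR
      obtain ⟨v, ⟨w, rfl⟩, hvR⟩ := hR
      exact ⟨.inl ⟨c v, ⟨v, hvR⟩, rfl⟩, he, Or.inl ⟨hvR, rfl⟩⟩
  · intro i j hij v hi hj
    have hij' : φ.symm i ≠ φ.symm j := fun h => hij (φ.symm.injective h)
    by_contra hv
    generalize φ.symm i = k at hi hij'
    generalize φ.symm j = k' at hj hij'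
    rcases k with l | e <;> rcases k' with l' | e'
    · exact hij' (congrArg _ (Subtype.ext ((hverts l v hi hv).symm.trans (hverts l' v hj hv))))
    · exact hv (e'.2 v hj)
    · exact hv (e.2 v hi)
    · exact hv (e.2 v hi)
  · intro i v hi hcard
    by_contra hv
    generalize φ.symm i = k at hi hcard
    rcases k with l | e
    · have hvl := hverts l v hi hv
      obtain ⟨w, hw⟩ := Set.ncard_eq_one.1 hcard
      have hvw : w ∈ (T (.inl l)).neighborSet v := hw ▸ rfl
      have hvw' : H.Adj v w := hvw.1
      obtain ⟨u, hvu, huw⟩ := not_leaf_of_minimal hfeas hvw' (hmin _ hvw') hv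
      have hu : u ∈ (T (.inl l)).neighborSet v := ⟨hvu, Or.inl ⟨hv, hvl⟩⟩
      exact huw (hw.subset hu)
    · exact hv (e.2 v hi)
  · intro i v hi hcard hv
    obtain ⟨a, ha, b, hb, hab⟩ := (Set.one_lt_ncard (Set.toFinite _)).1 hcard
    generalize φ.symm i = k at ha hb
    rcases k with l | e
    · exact hab (steinerSubgraph_adj_unique hc hcut hconst hmin hv ha hb)
    · have ha' : s(v, a) = e.1 := ha
      have hb' : s(v, b) = e.1 := hb
      exact hab (Sym2.congr_right.1 (ha'.trans hb'.symm))
  · intro s hs t ht hst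
    obtain ⟨P, hP, hPe, hPv⟩ := hc.exists_paths hs ht hst (hcut s hs t ht)
    refine ⟨P, ⟨hP, fun i j hij => ⟨hPe i j hij, fun v hi hj => hPv i j hij v hi v hj rfl⟩⟩, ?_⟩
    rintro i j ⟨e, hej, hei⟩ j' ⟨e', hej', hei'⟩
    by_contra hne
    generalize φ.symm i = k at hei hei'
    rcases k with l | f
    · have hmem : ∀ g ∈ (steinerSubgraph H R c l).edgeSet, ∃ u ∈ g, u ∉ R ∧ c u = l := by
        intro g hg
        induction g with
        | h a b =>
          rcases hg.2 with h | h
          · exact ⟨a, Sym2.mem_mk_left a b, h⟩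
          · exact ⟨b, Sym2.mem_mk_right a b, h⟩
      obtain ⟨u, hu, huR, hul⟩ := hmem e hei
      obtain ⟨u', hu', -, hul'⟩ := hmem e' hei'
      exact huR (hPv j j' hne u ((P j).mem_support_of_mem_edges hej hu) u'
        ((P j').mem_support_of_mem_edges hej' hu') (hul.trans hul'.symm))
    · have hmem : ∀ g ∈ (edgeSubgraph H f.1 f.1.2).edgeSet, g = f.1 := by
        intro g hg
        induction g with
        | h a b => exact hg
      obtain rfl := (hmem e hei).trans (hmem e' hei').symm
      exact hPe j j' hne e hej hej'
end

section
/- Let H be a minimal feasible solution to an EC-SNDP instance with graph G, terminal set R, and demands d_{s,t}. Then there exist subtrees T₁,…,T_b of H such that H = ⋃_{i=1}^b T_i, no two of the trees share an edge, every leaf of every tree is a terminal, and every internal vertex of every tree is a Steiner vertex. Moreover, for every terminal pair s,t ∈ R there exist d_{s,t} pairwise edge-disjoint s–t paths in H such that the edge set of each tree T_i (i ∈ {1,…,b}) intersects the edge set of at most one of these paths. -/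
open SimpleGraph

/-- A family of `n` pairwise edge-disjoint `s`-`t` paths. -/
def EdgeDisjPaths {V : Type*} (G : SimpleGraph V) (s t : V) (n : ℕ)
    (P : Fin n → G.Walk s t) : Prop :=
  (∀ i, (P i).IsPath) ∧ ∀ i j, i ≠ j → ∀ e, e ∈ (P i).edges → e ∉ (P j).edges

/-- The edge-connectivity `λ_G(s,t)`: the maximum number of pairwise
edge-disjoint `s`-`t` paths. -/
noncomputable def edgeConn {V : Type*} (G : SimpleGraph V) (s t : V) : ℕ :=
  sSup {n | ∃ P : Fin n → G.Walk s t, EdgeDisjPaths G s t n P}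

/-- Feasibility for EC-SNDP: the subgraph `H` satisfies all edge-connectivity
demands between distinct terminal pairs. -/
def ECFeasible {V : Type*} (H : SimpleGraph V) (R : Set V) (d : V → V → ℕ) : Prop :=
  ∀ s ∈ R, ∀ t ∈ R, s ≠ t → d s t ≤ edgeConn H s t

section Hypergraph

variable {V ι : Type*} [DecidableEq V]

/-- The indicator of the event that the hyperedge `a` crosses the vertex set `X`. -/
def crossInd (a X : Finset V) : ℕ :=
  if (∃ u ∈ a, u ∈ X) ∧ ∃ u ∈ a, u ∉ X then 1 else 0

/-- The number of hyperedges of the family `A` crossing the vertex set `X`. -/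
def hyperCut [Fintype ι] (A : ι → Finset V) (X : Finset V) : ℕ :=
  ∑ i, crossInd (A i) X

/-- The vertex set `X` contains exactly one of `s` and `t`. -/
def Separates (X : Finset V) (s t : V) : Prop := ¬ (s ∈ X ↔ t ∈ X)

/-- Every cut separating two terminals is crossed by as many hyperedges as they demand. -/
def MeetsDemands [Fintype ι] (A : ι → Finset V) (R : Set V) (d : V → V → ℕ) : Prop :=
  ∀ s ∈ R, ∀ t ∈ R, ∀ X, Separates X s t → d s t ≤ hyperCut A X

/-- `X` is a cut whose size equals one of the demands across it. -/
def TightCut [Fintype ι] (A : ι → Finset V) (R : Set V) (d : V → V → ℕ) (X : Finset V) : Prop :=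
  ∃ s ∈ R, ∃ t ∈ R, Separates X s t ∧ hyperCut A X ≤ d s t

/-- Each hyperedge `A i` arises by merging the hyperedges `A₀ j`, `j ∈ I i`, along vertices
outside `R`, and dropping some vertices. -/
structure Aggregates (A₀ : ι → Finset V) (R : Set V) (A : ι → Finset V) (I : ι → Set ι) :
    Prop where
  disjoint : ∀ i j, i ≠ j → ∀ k ∈ I i, k ∉ I j
  covers : ∀ i, ∀ u ∈ A i, ∃ j ∈ I i, u ∈ A₀ j
  linked : ∀ i, ∀ j ∈ I i, ∀ k ∈ I i,
    Relation.ReflTransGen (fun a b => b ∈ I i ∧ ∃ v, v ∉ R ∧ v ∈ A₀ a ∧ v ∈ A₀ b) j k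

lemma crossInd_compl [Fintype V] (a X : Finset V) : crossInd a Xᶜ = crossInd a X := by
  unfold crossInd
  simp only [Finset.mem_compl, not_not]
  exact if_congr and_comm rfl rfl

lemma hyperCut_compl [Fintype V] [Fintype ι] (A : ι → Finset V) (X : Finset V) :
    hyperCut A Xᶜ = hyperCut A X := by
  simp [hyperCut, crossInd_compl]

lemma TightCut.compl [Fintype V] [Fintype ι] {A : ι → Finset V} {R : Set V} {d : V → V → ℕ}
    {X : Finset V} (h : TightCut A R d X) : TightCut A R d Xᶜ := by
  obtain ⟨s, hs, t, ht, hX, hd⟩ := h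
  refine ⟨s, hs, t, ht, ?_, by rwa [hyperCut_compl]⟩
  simpa [Separates, not_iff_not] using hX

lemma crossInd_inter_add_union_le (a X Y : Finset V) :
    crossInd a (X ∩ Y) + crossInd a (X ∪ Y) ≤ crossInd a X + crossInd a Y := by
  unfold crossInd
  simp only [Finset.mem_inter, Finset.mem_union]
  split_ifs <;> first | omega | (exfalso; grind)

lemma crossInd_sdiff_add_sdiff_le (a X Y : Finset V) :
    crossInd a (X \ Y) + crossInd a (Y \ X) ≤ crossInd a X + crossInd a Y := by
  unfold crossInd
  simp only [Finset.mem_sdiff]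
  split_ifs <;> first | omega | (exfalso; grind)

lemma hyperCut_inter_add_union_le [Fintype ι] (A : ι → Finset V) (X Y : Finset V) :
    hyperCut A (X ∩ Y) + hyperCut A (X ∪ Y) ≤ hyperCut A X + hyperCut A Y := by
  simp only [hyperCut, ← Finset.sum_add_distrib]
  exact Finset.sum_le_sum fun i _ => crossInd_inter_add_union_le _ _ _

/-- Uncrossing of two tight cuts. -/
lemma TightCut.union_or_sdiff [Fintype ι] {A : ι → Finset V} {R : Set V}
    {d : V → V → ℕ} (hA : MeetsDemands A R d) {X Y : Finset V}
    (hX : TightCut A R d X) (hY : TightCut A R d Y) :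
    TightCut A R d (X ∪ Y) ∨
      hyperCut A X + hyperCut A Y ≤ hyperCut A (X \ Y) + hyperCut A (Y \ X) := by
  obtain ⟨s, hs, t, ht, hsX, hdX⟩ := hX
  obtain ⟨p, hp, q, hq, hpY, hdY⟩ := hY
  have hsub := hyperCut_inter_add_union_le A X Y
  have h1 := hA s hs t ht
  have h2 := hA p hp q hq
  have a1 := h1 (X ∩ Y)
  have a2 := h1 (X ∪ Y)
  have a3 := h1 (X \ Y)
  have a4 := h1 (Y \ X)
  have b1 := h2 (X ∩ Y)
  have b2 := h2 (X ∪ Y)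
  have b3 := h2 (X \ Y)
  have b4 := h2 (Y \ X)
  by_cases hU : TightCut A R d (X ∪ Y)
  · exact Or.inl hU
  right
  have c1 : Separates (X ∪ Y) s t → d s t < hyperCut A (X ∪ Y) := fun h => by
    by_contra hc
    exact hU ⟨s, hs, t, ht, h, not_lt.1 hc⟩
  have c2 : Separates (X ∪ Y) p q → d p q < hyperCut A (X ∪ Y) := fun h => by
    by_contra hc
    exact hU ⟨p, hp, q, hq, h, not_lt.1 hc⟩
  clear hA h1 h2 hU
  simp only [Separates, Finset.mem_union, Finset.mem_inter, Finset.mem_sdiff] at *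
  by_cases s ∈ X <;> by_cases s ∈ Y <;> by_cases t ∈ X <;> by_cases t ∈ Y <;>
  by_cases p ∈ X <;> by_cases p ∈ Y <;> by_cases q ∈ X <;> by_cases q ∈ Y <;>
  simp_all <;> omega

lemma crossInd_le_one (a X : Finset V) : crossInd a X ≤ 1 := by
  unfold crossInd
  split_ifs <;> omega

lemma crossInd_pos_iff {a X : Finset V} :
    0 < crossInd a X ↔ (∃ u ∈ a, u ∈ X) ∧ ∃ u ∈ a, u ∉ X := by
  unfold crossInd
  split_ifs with h
  · exact iff_of_true one_pos h
  · exact iff_of_false (lt_irrefl 0) h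

lemma crossInd_mono {a b X : Finset V} (h : a ⊆ b) : crossInd a X ≤ crossInd b X := by
  unfold crossInd
  split_ifs <;> first | omega | (exfalso; grind)

lemma exists_hyperedge_disjoint [Fintype ι] {A : ι → Finset V} {R : Set V} {d : V → V → ℕ}
    (hA : MeetsDemands A R d) {X : Finset V} (hX : TightCut A R d X) {v : V} (hvR : v ∉ R)
    (hvX : v ∉ X) {e : ι} (hve : v ∈ A e) (hsub : A e ⊆ insert v X) (hmeet : ∃ u ∈ A e, u ∈ X) :
    ∃ f, v ∈ A f ∧ ∀ u ∈ A f, u ∉ X := by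
  by_contra! hcon
  obtain ⟨s, hs, t, ht, hsX, hd⟩ := hX
  have hsv : s ≠ v := fun h => hvR (h ▸ hs)
  have htv : t ≠ v := fun h => hvR (h ▸ ht)
  have h1 := hA s hs t ht (insert v X) (by simpa [Separates, hsv, htv] using hsX)
  have h2 : hyperCut A (insert v X) < hyperCut A X := by
    refine Finset.sum_lt_sum (fun i _ => ?_) ⟨e, Finset.mem_univ _, ?_⟩
    · have := hcon i
      unfold crossInd
      simp only [Finset.mem_insert]
      split_ifs <;> first | omega | (exfalso; grind)
    · have : crossInd (A e) (insert v X) = 0 := by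
        by_contra hne
        obtain ⟨-, u, hu, hu'⟩ := crossInd_pos_iff.1 (Nat.pos_of_ne_zero hne)
        exact hu' (hsub hu)
      rw [this]
      exact crossInd_pos_iff.2 ⟨hmeet, v, hve, hvX⟩
  omega

/-- If dropping `v` from a hyperedge violates a demand, some tight cut explains it. -/
lemma exists_tightCut_of_not_trim [Fintype V] [Fintype ι] [DecidableEq ι] {A : ι → Finset V}
    {R : Set V} {d : V → V → ℕ} (hA : MeetsDemands A R d) {v : V} {e : ι}
    (hB : ¬ MeetsDemands (Function.update A e ((A e).erase v)) R d) :
    ∃ X, TightCut A R d X ∧ v ∉ X ∧ A e ⊆ insert v X ∧ ∃ u ∈ A e, u ∈ X := by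
  unfold MeetsDemands at hB
  push Not at hB
  obtain ⟨s, hs, t, ht, X, hsX, hlt⟩ := hB
  set B := Function.update A e ((A e).erase v) with hBdef
  have hsum : ∀ C : ι → Finset V,
      hyperCut C X = crossInd (C e) X + ∑ i ∈ Finset.univ.erase e, crossInd (C i) X := fun C =>
    (Finset.add_sum_erase _ (fun i => crossInd (C i) X) (Finset.mem_univ e)).symm
  have hrest : ∑ i ∈ Finset.univ.erase e, crossInd (B i) X =
      ∑ i ∈ Finset.univ.erase e, crossInd (A i) X :=
    Finset.sum_congr rfl fun i hi => by
      rw [hBdef, Function.update_of_ne (Finset.ne_of_mem_erase hi)]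
  have hBe : B e = (A e).erase v := by simp [hBdef]
  have hAX := hA s hs t ht X hsX
  have h1 := hsum A
  have h2 := hsum B
  rw [hrest, hBe] at h2
  have h3 := crossInd_le_one (A e) X
  have htight : TightCut A R d X := ⟨s, hs, t, ht, hsX, by omega⟩
  have hpos : 0 < crossInd (A e) X := by omega
  have hzero : ¬ 0 < crossInd ((A e).erase v) X := by omega
  rw [crossInd_pos_iff] at hpos hzero
  by_cases hv : v ∈ X
  · refine ⟨Xᶜ, htight.compl, by simpa using hv, fun u hu => ?_, by simpa using hpos.2⟩
    rw [Finset.mem_insert, Finset.mem_compl]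
    by_contra! hcon
    obtain ⟨w, hw, hwX⟩ := hpos.2
    exact hzero ⟨⟨u, Finset.mem_erase.2 ⟨hcon.1, hu⟩, hcon.2⟩, w,
      Finset.mem_erase.2 ⟨fun h => hwX (h ▸ hv), hw⟩, hwX⟩
  · refine ⟨X, htight, hv, fun u hu => ?_, hpos.1⟩
    rw [Finset.mem_insert]
    by_contra! hcon
    obtain ⟨w, hw, hwX⟩ := hpos.1
    exact hzero ⟨⟨w, Finset.mem_erase.2 ⟨fun h => hv (h ▸ hwX), hw⟩, hwX⟩, u,
      Finset.mem_erase.2 ⟨hcon.1, hu⟩, hcon.2⟩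

/-- If merging two hyperedges at `v` violates a demand, some tight cut crosses both. -/
lemma exists_tightCut_of_not_merge [Fintype V] [Fintype ι] [DecidableEq ι] {A : ι → Finset V}
    {R : Set V} {d : V → V → ℕ} (hA : MeetsDemands A R d) {v : V} {e f : ι} (hef : e ≠ f)
    (hB : ¬ MeetsDemands (Function.update (Function.update A e (A e ∪ A f)) f ∅) R d) :
    ∃ X, TightCut A R d X ∧ v ∉ X ∧ (∃ u ∈ A e, u ∈ X) ∧ ∃ u ∈ A f, u ∈ X := by
  unfold MeetsDemands at hB
  push Not at hB
  obtain ⟨s, hs, t, ht, X, hsX, hlt⟩ := hB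
  set B := Function.update (Function.update A e (A e ∪ A f)) f ∅ with hBdef
  have hsum : ∀ C : ι → Finset V, hyperCut C X = crossInd (C e) X +
      (crossInd (C f) X + ∑ i ∈ (Finset.univ.erase e).erase f, crossInd (C i) X) := fun C => by
    rw [Finset.add_sum_erase _ (fun i => crossInd (C i) X)
      (Finset.mem_erase.2 ⟨hef.symm, Finset.mem_univ f⟩)]
    exact (Finset.add_sum_erase _ (fun i => crossInd (C i) X) (Finset.mem_univ e)).symm
  have hrest : ∑ i ∈ (Finset.univ.erase e).erase f, crossInd (B i) X =
      ∑ i ∈ (Finset.univ.erase e).erase f, crossInd (A i) X :=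
    Finset.sum_congr rfl fun i hi => by
      simp only [Finset.mem_erase] at hi
      rw [hBdef, Function.update_of_ne hi.1, Function.update_of_ne hi.2.1]
  have hBe : B e = A e ∪ A f := by simp [hBdef, hef]
  have hAX := hA s hs t ht X hsX
  have h1 := hsum A
  have h2 := hsum B
  rw [hrest, hBe] at h2
  have h3 := crossInd_le_one (A e) X
  have h4 := crossInd_le_one (A f) X
  have h5 : crossInd (A e) X ≤ crossInd (A e ∪ A f) X := crossInd_mono Finset.subset_union_left
  have h6 : crossInd (A f) X ≤ crossInd (A e ∪ A f) X := crossInd_mono Finset.subset_union_right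
  have htight : TightCut A R d X := ⟨s, hs, t, ht, hsX, by omega⟩
  have hpos : 0 < crossInd (A e) X := by omega
  have hpos' : 0 < crossInd (A f) X := by omega
  rw [crossInd_pos_iff] at hpos hpos'
  by_cases hv : v ∈ X
  · exact ⟨Xᶜ, htight.compl, by simpa using hv, by simpa using hpos.2, by simpa using hpos'.2⟩
  · exact ⟨X, htight, hv, hpos.1, hpos'.1⟩

/-- At any vertex outside `R`, some hyperedge can drop it or two hyperedges can be merged. -/
lemma MeetsDemands.trim_or_merge [Fintype V] [Fintype ι] [DecidableEq ι] {A : ι → Finset V}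
    {R : Set V} {d : V → V → ℕ} (hA : MeetsDemands A R d) {v : V} (hvR : v ∉ R) {e : ι}
    (hve : v ∈ A e) :
    MeetsDemands (Function.update A e ((A e).erase v)) R d ∨
      ∃ f, e ≠ f ∧ v ∈ A f ∧
        MeetsDemands (Function.update (Function.update A e (A e ∪ A f)) f ∅) R d := by
  by_cases hB : MeetsDemands (Function.update A e ((A e).erase v)) R d
  · exact Or.inl hB
  right
  obtain ⟨X₀, hX₀, hvX₀, hsub₀, hmeet₀⟩ := exists_tightCut_of_not_trim hA hB
  obtain ⟨X, hle, hmax⟩ := Set.Finite.exists_le_maximal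
    (Set.toFinite {X | TightCut A R d X ∧ v ∉ X}) ⟨hX₀, hvX₀⟩
  obtain ⟨hX, hvX⟩ := hmax.prop
  have hsub : A e ⊆ insert v X := hsub₀.trans (Finset.insert_subset_insert v hle)
  obtain ⟨u, hue, huX₀⟩ := hmeet₀
  have huX := hle huX₀
  obtain ⟨f, hvf, hf⟩ := exists_hyperedge_disjoint hA hX hvR hvX hve hsub ⟨u, hue, huX⟩
  have hef : e ≠ f := fun h => hf u (h ▸ hue) huX
  refine ⟨f, hef, hvf, ?_⟩
  by_contra hC
  obtain ⟨Z, hZ, hvZ, ⟨w, hwe, hwZ⟩, y, hyf, hyZ⟩ := exists_tightCut_of_not_merge (v := v) hA hef hC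
  rcases hX.union_or_sdiff hA hZ with hU | hle'
  · have := hmax.le_of_ge (y := X ∪ Z) ⟨hU, by simp [hvX, hvZ]⟩ Finset.subset_union_left
    exact hf y hyf (this (Finset.mem_union_right X hyZ))
  · have hlt : hyperCut A (X \ Z) + hyperCut A (Z \ X) < hyperCut A X + hyperCut A Z := by
      simp only [hyperCut, ← Finset.sum_add_distrib]
      refine Finset.sum_lt_sum (fun i _ => crossInd_sdiff_add_sdiff_le _ _ _)
        ⟨e, Finset.mem_univ _, ?_⟩
      have h1 : 0 < crossInd (A e) X := crossInd_pos_iff.2 ⟨⟨u, hue, huX⟩, v, hve, hvX⟩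
      have h2 : 0 < crossInd (A e) Z := crossInd_pos_iff.2 ⟨⟨w, hwe, hwZ⟩, v, hve, hvZ⟩
      have h3 : ¬ 0 < crossInd (A e) (Z \ X) := by
        rw [crossInd_pos_iff]
        grind
      have h4 := crossInd_le_one (A e) (X \ Z)
      omega
    omega

omit [DecidableEq V] in
lemma Aggregates.mono {A₀ A A' : ι → Finset V} {R : Set V} {I : ι → Set ι}
    (h : Aggregates A₀ R A I) (hsub : ∀ i, A' i ⊆ A i) : Aggregates A₀ R A' I :=
  ⟨h.disjoint, fun i u hu => h.covers i u (hsub i hu), h.linked⟩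

lemma Aggregates.merge [DecidableEq ι] {A₀ A : ι → Finset V} {R : Set V} {I : ι → Set ι}
    (h : Aggregates A₀ R A I) {e f : ι} (hef : e ≠ f) {v : V} (hvR : v ∉ R) (hve : v ∈ A e)
    (hvf : v ∈ A f) :
    Aggregates A₀ R (Function.update (Function.update A e (A e ∪ A f)) f ∅)
      (Function.update (Function.update I e (I e ∪ I f)) f ∅) where
  disjoint i j hij k hki hkj := by
    have hd := h.disjoint
    simp only [Function.update_apply] at hki hkj
    grind
  covers i u hu := by
    have hc := h.covers
    simp only [Function.update_apply] at hu ⊢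
    grind
  linked i j hj k hk := by
    obtain ⟨p, hp, hvp⟩ := h.covers e v hve
    obtain ⟨q, hq, hvq⟩ := h.covers f v hvf
    by_cases hif : i = f
    · subst hif
      simp at hj
    by_cases hie : i = e
    · subst hie
      simp only [Function.update_of_ne hef, Function.update_self] at hj hk ⊢
      have hl : ∀ j ∈ I i, ∀ k ∈ I i, Relation.ReflTransGen (fun a b => b ∈ I i ∪ I f ∧
          ∃ v, v ∉ R ∧ v ∈ A₀ a ∧ v ∈ A₀ b) j k := fun j hj k hk =>
        Relation.ReflTransGen.mono (fun a b hab => ⟨Or.inl hab.1, hab.2⟩) _ _ (h.linked i j hj k hk)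
      have hr : ∀ j ∈ I f, ∀ k ∈ I f, Relation.ReflTransGen (fun a b => b ∈ I i ∪ I f ∧
          ∃ v, v ∉ R ∧ v ∈ A₀ a ∧ v ∈ A₀ b) j k := fun j hj k hk =>
        Relation.ReflTransGen.mono (fun a b hab => ⟨Or.inr hab.1, hab.2⟩) _ _ (h.linked f j hj k hk)
      rcases hj with hj | hj <;> rcases hk with hk | hk
      · exact hl j hj k hk
      · exact ((hl j hj p hp).tail ⟨Or.inr hq, v, hvR, hvp, hvq⟩).trans (hr q hq k hk)
      · exact ((hr j hj q hq).tail ⟨Or.inl hp, v, hvR, hvq, hvp⟩).trans (hl p hp k hk)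
      · exact hr j hj k hk
    · simp only [Function.update_of_ne hif, Function.update_of_ne hie] at hj hk ⊢
      exact h.linked i j hj k hk

/-- All vertices outside `R` can be eliminated from a hypergraph by merging and trimming
hyperedges while all cut demands between vertices of `R` stay satisfied. -/
theorem exists_aggregates_subset [Fintype V] [Fintype ι] {A₀ : ι → Finset V} {R : Set V}
    {d : V → V → ℕ} (h₀ : MeetsDemands A₀ R d) :
    ∃ (A : ι → Finset V) (I : ι → Set ι), Aggregates A₀ R A I ∧ MeetsDemands A R d ∧
      ∀ i, ∀ u ∈ A i, u ∈ R := by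
  classical
  suffices H : ∀ (n : ℕ) (A : ι → Finset V) (I : ι → Set ι), ∑ i, (A i).card = n →
      Aggregates A₀ R A I → MeetsDemands A R d →
      ∃ (A : ι → Finset V) (I : ι → Set ι), Aggregates A₀ R A I ∧ MeetsDemands A R d ∧
        ∀ i, ∀ u ∈ A i, u ∈ R by
    refine H _ A₀ (fun i => {i}) rfl ⟨?_, ?_, ?_⟩ h₀
    · grind
    · grind
    · rintro i j rfl k rfl
      exact .refl
  intro n
  induction n using Nat.strong_induction_on with
  | _ n ih =>
    rintro A I rfl hI hA
    by_cases hR : ∀ i, ∀ u ∈ A i, u ∈ R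
    · exact ⟨A, I, hI, hA, hR⟩
    push Not at hR
    obtain ⟨e, v, hve, hvR⟩ := hR
    rcases hA.trim_or_merge hvR hve with hB | ⟨f, hef, hvf, hB⟩
    · have hsub : ∀ i, Function.update A e ((A e).erase v) i ⊆ A i := fun i => by
        rw [Function.update_apply]
        split_ifs with h
        · rw [h]
          exact Finset.erase_subset _ _
        · exact subset_rfl
      refine ih _ ?_ _ I rfl (hI.mono hsub) hB
      refine Finset.sum_lt_sum (fun i _ => Finset.card_le_card (hsub i))
        ⟨e, Finset.mem_univ _, ?_⟩
      simpa using Finset.card_erase_lt_of_mem hve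
    · refine ih _ ?_ _ _ rfl (hI.merge hef hvR hve hvf) hB
      have hsum : ∀ C : ι → Finset V, ∑ i, (C i).card = (C e).card +
          ((C f).card + ∑ i ∈ (Finset.univ.erase e).erase f, (C i).card) := fun C => by
        rw [Finset.add_sum_erase _ (fun i => (C i).card)
          (Finset.mem_erase.2 ⟨hef.symm, Finset.mem_univ f⟩)]
        exact (Finset.add_sum_erase _ (fun i => (C i).card) (Finset.mem_univ e)).symm
      rw [hsum A, hsum]
      have hrest : ∑ i ∈ (Finset.univ.erase e).erase f,
          (Function.update (Function.update A e (A e ∪ A f)) f ∅ i).card =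
          ∑ i ∈ (Finset.univ.erase e).erase f, (A i).card :=
        Finset.sum_congr rfl fun i hi => by
          simp only [Finset.mem_erase] at hi
          rw [Function.update_of_ne hi.1, Function.update_of_ne hi.2.1]
      rw [hrest]
      have h1 := Finset.card_union_add_card_inter (A e) (A f)
      have h2 : 0 < (A e ∩ A f).card := Finset.card_pos.2 ⟨v, by simp [hve, hvf]⟩
      simp only [Function.update_of_ne hef, Function.update_self, Finset.card_empty]
      omega

end Hypergraph

section Paths

variable {V ι : Type*} [DecidableEq V]

lemma hyperCut_eq_card [Fintype ι] (A : ι → Finset V) (X : Finset V) :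
    hyperCut A X = Fintype.card {i // 0 < crossInd (A i) X} := by
  rw [Fintype.card_subtype, Finset.card_filter]
  refine Finset.sum_congr rfl fun i _ => ?_
  have := crossInd_le_one (A i) X
  split_ifs <;> omega

omit [DecidableEq V] in
lemma exists_mem_edges {G : SimpleGraph V} {s t : V} (hst : s ≠ t) (p : G.Walk s t) :
    ∃ e, e ∈ p.edges := by
  cases p with
  | nil => exact absurd rfl hst
  | cons h p => exact ⟨_, List.mem_cons_self⟩

omit [DecidableEq V] in
lemma bddAbove_edgeDisjPaths [Finite V] (G : SimpleGraph V) {s t : V} (hst : s ≠ t) :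
    BddAbove {n | ∃ P : Fin n → G.Walk s t, EdgeDisjPaths G s t n P} := by
  refine ⟨Nat.card (Sym2 V), ?_⟩
  rintro n ⟨P, -, hP⟩
  choose f hf using fun i => exists_mem_edges hst (P i)
  have hinj : Function.Injective f := fun i j hij => by
    by_contra hne
    exact hP i j hne (f i) (hf i) (hij ▸ hf j)
  simpa using Nat.card_le_card_of_injective f hinj

omit [DecidableEq V] in
lemma EdgeDisjPaths.le_edgeConn [Finite V] {G : SimpleGraph V} {s t : V} (hst : s ≠ t) {n : ℕ}
    {P : Fin n → G.Walk s t} (hP : EdgeDisjPaths G s t n P) : n ≤ edgeConn G s t :=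
  le_csSup (bddAbove_edgeDisjPaths G hst) ⟨P, hP⟩

omit [DecidableEq V] in
lemma exists_edgeDisjPaths_of_le_edgeConn [Finite V] {G : SimpleGraph V} {s t : V} (hst : s ≠ t)
    {n : ℕ} (hn : n ≤ edgeConn G s t) : ∃ P : Fin n → G.Walk s t, EdgeDisjPaths G s t n P := by
  obtain ⟨P, hP, hP'⟩ := Nat.sSup_mem (s := {n | ∃ P : Fin n → G.Walk s t, EdgeDisjPaths G s t n P})
    ⟨0, Fin.elim0, fun i => i.elim0, fun i => i.elim0⟩ (bddAbove_edgeDisjPaths G hst)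
  refine ⟨fun i => P (Fin.castLE hn i), fun i => hP _, fun i j hij => hP' _ _ fun h => hij ?_⟩
  exact Fin.castLE_injective hn h

/-- Viewing the edges of a feasible graph as hyperedges, all cuts meet the demands. -/
lemma ECFeasible.meetsDemands [Fintype V] {H : SimpleGraph V} [Fintype H.edgeSet] {R : Set V}
    {d : V → V → ℕ} (h : ECFeasible H R d) :
    MeetsDemands (fun e : H.edgeSet => (e : Sym2 V).toFinset) R d := by
  intro s hs t ht X hX
  have hst : s ≠ t := fun h => hX (by rw [h])
  obtain ⟨P, -, hP⟩ := exists_edgeDisjPaths_of_le_edgeConn hst (h s hs t ht hst)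
  have key : ∀ p : H.Walk s t, ∃ e ∈ p.edges, 0 < crossInd e.toFinset X := by
    intro p
    have hcross : ∀ a : H.Dart, (a.fst ∈ X ∧ a.snd ∉ X ∨ a.fst ∉ X ∧ a.snd ∈ X) →
        0 < crossInd a.edge.toFinset X := by
      intro a ha
      have h1 : a.fst ∈ a.edge.toFinset := Sym2.mem_toFinset.2 (Sym2.mem_mk_left _ _)
      have h2 : a.snd ∈ a.edge.toFinset := Sym2.mem_toFinset.2 (Sym2.mem_mk_right _ _)
      rw [crossInd_pos_iff]
      rcases ha with ⟨ha, ha'⟩ | ⟨ha, ha'⟩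
      · exact ⟨⟨_, h1, ha⟩, _, h2, ha'⟩
      · exact ⟨⟨_, h2, ha'⟩, _, h1, ha⟩
    by_cases hsX : s ∈ X
    · have htX : t ∉ X := fun ht => hX (iff_of_true hsX ht)
      obtain ⟨a, ha, ha1, ha2⟩ := p.exists_boundary_dart (X : Set V) (by simpa) (by simpa)
      exact ⟨a.edge, List.mem_map_of_mem ha,
        hcross a (Or.inl ⟨by simpa using ha1, by simpa using ha2⟩)⟩
    · have htX : t ∈ X := by
        by_contra ht
        exact hX (iff_of_false hsX ht)
      obtain ⟨a, ha, ha1, ha2⟩ := p.exists_boundary_dart (X : Set V)ᶜ (by simpa) (by simpa)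
      exact ⟨a.edge, List.mem_map_of_mem ha,
        hcross a (Or.inr ⟨by simpa using ha1, by simpa using ha2⟩)⟩
  choose f hf hfX using fun j => key (P j)
  rw [hyperCut_eq_card]
  let g : Fin (d s t) → {e : H.edgeSet // 0 < crossInd (e : Sym2 V).toFinset X} :=
    fun j => ⟨⟨f j, (P j).edges_subset_edgeSet (hf j)⟩, hfX j⟩
  have hg : Function.Injective g := fun i j hij => by
    by_contra hne
    have hfij : f i = f j := congrArg (fun e => (e.1.1 : Sym2 V)) hij
    exact hP i j hne (f i) (hf i) (hfij ▸ hf j)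
  simpa using Fintype.card_le_of_injective g hg

omit [DecidableEq V] in
lemma Aggregates.reachable {A₀ A : ι → Finset V} {R : Set V} {I : ι → Set ι}
    (h : Aggregates A₀ R A I) {K : ι → SimpleGraph V}
    (hK : ∀ j, ∀ u ∈ A₀ j, ∀ w ∈ A₀ j, (K j).Reachable u w) (i : ι) {u w : V}
    (hu : u ∈ A i) (hw : w ∈ A i) : (⨆ j ∈ I i, K j).Reachable u w := by
  obtain ⟨j, hj, huj⟩ := h.covers i u hu
  obtain ⟨k, hk, hwk⟩ := h.covers i w hw
  have hK' : ∀ j ∈ I i, ∀ u ∈ A₀ j, ∀ w ∈ A₀ j, (⨆ j ∈ I i, K j).Reachable u w :=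
    fun j hj u hu w hw => (hK j u hu w hw).mono (le_iSup₂ (f := fun j (_ : j ∈ I i) => K j) j hj)
  suffices H : ∀ x ∈ A₀ k, (⨆ j ∈ I i, K j).Reachable u x from H w hwk
  clear hwk hw
  have hl := h.linked i j hj k hk
  clear hk
  induction hl with
  | refl => exact hK' j hj u huj
  | tail _ hbc ih =>
    obtain ⟨hc, v, -, hvb, hvc⟩ := hbc
    exact fun x hx => (ih v hvb).trans (hK' _ hc v hvc x hx)

/-- A Menger-type theorem: if every `s`-`t` cut is crossed by `n` of the connected pieces `K i`,
then there are `n` edge-disjoint paths no two of which use the same piece. -/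
theorem exists_edgeDisjPaths_of_le_hyperCut [Fintype V] [Fintype ι] {H : SimpleGraph V}
    {K : ι → SimpleGraph V} (hKH : ∀ i, K i ≤ H)
    (hdisj : ∀ i j, i ≠ j → ∀ e ∈ (K i).edgeSet, e ∉ (K j).edgeSet) {A : ι → Finset V}
    (hreach : ∀ i, ∀ u ∈ A i, ∀ w ∈ A i, (K i).Reachable u w) {s t : V} (hst : s ≠ t) {n : ℕ}
    (hcut : ∀ X, Separates X s t → n ≤ hyperCut A X) :
    ∃ P : Fin n → H.Walk s t, EdgeDisjPaths H s t n P ∧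
      ∀ i, {j | ∃ e ∈ (P j).edges, e ∈ (K i).edgeSet}.Subsingleton := by
  have hmeets : MeetsDemands A ({s, t} : Set V) (fun _ _ => n) := by
    rintro p hp q hq X hX
    refine hcut X ?_
    simp only [Set.mem_insert_iff, Set.mem_singleton_iff] at hp hq
    unfold Separates at hX ⊢
    grind
  obtain ⟨B, I, hI, hB, hBst⟩ := exists_aggregates_subset hmeets
  have hn : n ≤ hyperCut B {s} :=
    hB s (by simp) t (by simp) {s} (by simp [Separates, hst.symm])
  rw [hyperCut_eq_card] at hn
  obtain ⟨g⟩ : Nonempty (Fin n ↪ {i // 0 < crossInd (B i) {s}}) :=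
    Function.Embedding.nonempty_of_card_le (by simpa using hn)
  have hmem : ∀ j, s ∈ B (g j).1 ∧ t ∈ B (g j).1 := by
    intro j
    obtain ⟨⟨u, hu, hus⟩, w, hw, hws⟩ := crossInd_pos_iff.1 (g j).2
    rw [Finset.mem_singleton] at hus hws
    have := hBst _ w hw
    simp only [Set.mem_insert_iff, Set.mem_singleton_iff, hws, false_or] at this
    exact ⟨hus ▸ hu, this ▸ hw⟩
  have hle : ∀ i, ⨆ j ∈ I i, K j ≤ H := fun i => iSup₂_le fun j _ => hKH j
  choose p hp using fun j => (hI.reachable hreach (g j).1 (hmem j).1 (hmem j).2).exists_isPath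
  have hedge : ∀ j, ∀ e ∈ (p j).edges, ∃ k ∈ I (g j).1, e ∈ (K k).edgeSet := by
    intro j e he
    have := (p j).edges_subset_edgeSet he
    induction e with
    | h u w => simpa only [mem_edgeSet, iSup_adj, exists_prop] using this
  have huniq : ∀ i j k, (∃ e ∈ (p j).edges, e ∈ (K i).edgeSet) →
      (∃ e ∈ (p k).edges, e ∈ (K i).edgeSet) → j = k := by
    have hmemI : ∀ i j, (∃ e ∈ (p j).edges, e ∈ (K i).edgeSet) → i ∈ I (g j).1 := by
      rintro i j ⟨e, he, hei⟩
      obtain ⟨k, hk, hek⟩ := hedge j e he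
      by_cases hik : i = k
      · exact hik ▸ hk
      · exact absurd hek (hdisj i k hik e hei)
    intro i j k hj hk
    by_contra hne
    exact hI.disjoint _ _ (fun h => hne (g.injective (Subtype.ext h))) i (hmemI i j hj)
      (hmemI i k hk)
  refine ⟨fun j => (p j).mapLe (hle _), ⟨fun j => (hp j).mapLe _, ?_⟩, ?_⟩
  · intro j k hjk e hej hek
    rw [Walk.edges_mapLe_eq_edges] at hej hek
    obtain ⟨i, -, hi⟩ := hedge j e hej
    exact hjk (huniq i j k ⟨e, hej, hi⟩ ⟨e, hek, hi⟩)
  · intro i j hj k hk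
    simp only [Set.mem_ofPred_eq, Walk.edges_mapLe_eq_edges] at hj hk
    exact huniq i j k hj hk

/-- A family of edge-disjoint subgraphs `K i` of `H`, each connecting its set `A i`, such that the
sets `A i` as hyperedges meet all demands. -/
structure ConnectingFamily [Fintype ι] (H : SimpleGraph V) (R : Set V) (d : V → V → ℕ)
    (K : ι → SimpleGraph V) (A : ι → Finset V) : Prop where
  le : ∀ i, K i ≤ H
  disjoint : ∀ i j, i ≠ j → ∀ e ∈ (K i).edgeSet, e ∉ (K j).edgeSet
  reachable : ∀ i, ∀ u ∈ A i, ∀ w ∈ A i, (K i).Reachable u w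
  meets : MeetsDemands A R d

lemma ConnectingFamily.exists_mem_edgeSet [Fintype V] [Fintype ι] {H : SimpleGraph V} {R : Set V}
    {d : V → V → ℕ} (hmin : ∀ e ∈ H.edgeSet, ¬ ECFeasible (H.deleteEdges {e}) R d)
    {K : ι → SimpleGraph V} {A : ι → Finset V} (h : ConnectingFamily H R d K A) {e : Sym2 V}
    (he : e ∈ H.edgeSet) : ∃ i, e ∈ (K i).edgeSet := by
  by_contra! hcon
  refine hmin e he fun s hs t ht hst => ?_
  have hle : ∀ i, K i ≤ H.deleteEdges {e} := fun i u w huw => by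
    rw [deleteEdges_adj]
    refine ⟨h.le i huw, fun hmem => hcon i ?_⟩
    rw [Set.mem_singleton_iff] at hmem
    rwa [← hmem]
  obtain ⟨P, hP, -⟩ := exists_edgeDisjPaths_of_le_hyperCut hle h.disjoint h.reachable hst
    fun X hX => h.meets s hs t ht X hX
  exact hP.le_edgeConn hst

/-- In a minimal solution, every edge of a piece `K i` is needed to connect `A i`. -/
lemma ConnectingFamily.exists_not_reachable [Fintype V] [Fintype ι] {H : SimpleGraph V} {R : Set V}
    {d : V → V → ℕ} (hmin : ∀ e ∈ H.edgeSet, ¬ ECFeasible (H.deleteEdges {e}) R d)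
    {K : ι → SimpleGraph V} {A : ι → Finset V} (h : ConnectingFamily H R d K A) {i : ι}
    {e : Sym2 V} (he : e ∈ (K i).edgeSet) :
    ∃ u ∈ A i, ∃ w ∈ A i, ¬ ((K i).deleteEdges {e}).Reachable u w := by
  classical
  by_contra! hcon
  have hsub : ∀ j, Function.update K i ((K i).deleteEdges {e}) j ≤ K j := fun j => by
    rw [Function.update_apply]
    split_ifs with hj
    · exact hj ▸ deleteEdges_le _
    · exact le_rfl
  have hfam : ConnectingFamily H R d (Function.update K i ((K i).deleteEdges {e})) A := by
    refine ⟨fun j => (hsub j).trans (h.le j), fun j k hjk f hf hf' => ?_, fun j u hu w hw => ?_,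
      h.meets⟩
    · exact h.disjoint j k hjk f (edgeSet_mono (hsub j) hf) (edgeSet_mono (hsub k) hf')
    · rw [Function.update_apply]
      split_ifs with hj
      · subst hj
        exact hcon u hu w hw
      · exact h.reachable j u hu w hw
  obtain ⟨j, hj⟩ := hfam.exists_mem_edgeSet hmin (edgeSet_mono (h.le i) he)
  by_cases hji : j = i
  · subst hji
    simp [edgeSet_deleteEdges] at hj
  · exact h.disjoint j i hji e (edgeSet_mono (hsub j) hj) he

end Paths

section Trees

variable {V : Type*}

lemma reachable_of_adj_reachable {G G' : SimpleGraph V} (φ : V → V)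
    (h : ∀ a b, G.Adj a b → G'.Reachable (φ a) (φ b)) {u w : V} (huw : G.Reachable u w) :
    G'.Reachable (φ u) (φ w) := by
  obtain ⟨p⟩ := huw
  induction p with
  | nil => exact .refl _
  | cons hab _ ih => exact (h _ _ hab).trans ih

/-- If every edge of `G` is needed to connect some two vertices, then `G` is a forest. -/
lemma isAcyclic_of_exists_not_reachable {G : SimpleGraph V} {A : Set V}
    (hA : ∀ u ∈ A, ∀ w ∈ A, G.Reachable u w)
    (h : ∀ e ∈ G.edgeSet, ∃ u ∈ A, ∃ w ∈ A, ¬ (G.deleteEdges {e}).Reachable u w) :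
    G.IsAcyclic := by
  rw [isAcyclic_iff_forall_isBridge]
  intro e he
  obtain ⟨u, hu, w, hw, hne⟩ := h e he
  induction e with
  | h x y =>
  rw [isBridge_iff]
  intro hxy
  refine hne (reachable_of_adj_reachable id (fun a b hab => ?_) (hA u hu w hw))
  by_cases hs : s(a, b) = s(x, y)
  · rcases Sym2.eq_iff.1 hs with ⟨rfl, rfl⟩ | ⟨rfl, rfl⟩
    · exact hxy
    · exact hxy.symm
  · exact Adj.reachable (deleteEdges_adj.2 ⟨hab, by simpa using hs⟩)

/-- If every edge of `G` is needed to connect some two vertices of `A`, then each vertex of degree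
one lies in `A`. -/
lemma mem_of_neighborSet_eq_singleton {G : SimpleGraph V} {A : Set V}
    (hA : ∀ u ∈ A, ∀ w ∈ A, G.Reachable u w)
    (h : ∀ e ∈ G.edgeSet, ∃ u ∈ A, ∃ w ∈ A, ¬ (G.deleteEdges {e}).Reachable u w) {v x : V}
    (hv : G.neighborSet v = {x}) : v ∈ A := by
  classical
  have hadj : ∀ y, G.Adj v y ↔ y = x := fun y => by
    rw [← mem_neighborSet, hv, Set.mem_singleton_iff]
  by_contra hvA
  obtain ⟨u, hu, w, hw, hne⟩ := h s(v, x) ((hadj x).2 rfl)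
  have huv : u ≠ v := fun h => hvA (h ▸ hu)
  have hwv : w ≠ v := fun h => hvA (h ▸ hw)
  have := reachable_of_adj_reachable (G' := G.deleteEdges {s(v, x)})
    (fun a => if a = v then x else a) (fun a b hab => ?_) (hA u hu w hw)
  · rw [if_neg huv, if_neg hwv] at this
    exact hne this
  · by_cases ha : a = v
    · subst ha
      have hb := (hadj b).1 hab
      subst hb
      simp [hab.ne']
    · by_cases hb : b = v
      · subst hb
        have ha' := (hadj a).1 hab.symm
        subst ha'
        simp [hab.ne]
      · rw [if_neg ha, if_neg hb]
        refine Adj.reachable (deleteEdges_adj.2 ⟨hab, ?_⟩)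
        simp [ha, hb]

/-- The connected component of `r` in the subgraph `K` of `H`, as a subgraph of `H`. -/
def componentSubgraph {H K : SimpleGraph V} (hKH : K ≤ H) (r : V) : H.Subgraph where
  verts := (K.connectedComponentMk r).supp
  Adj u w := K.Adj u w ∧ u ∈ (K.connectedComponentMk r).supp
  adj_sub h := hKH h.1
  edge_vert h := h.2
  symm := ⟨fun _ _ h => ⟨h.1.symm,
    (ConnectedComponent.mem_supp_congr_adj _ h.1).1 h.2⟩⟩

lemma componentSubgraph_coe_isTree {H K : SimpleGraph V} (hKH : K ≤ H) (r : V)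
    (hK : K.IsAcyclic) : (componentSubgraph hKH r).coe.IsTree := by
  have : (componentSubgraph hKH r).coe = (K.connectedComponentMk r).toSimpleGraph := by
    ext u w
    exact and_iff_left u.2
  rw [this]
  exact hK.isTree_connectedComponent _

lemma neighborSet_componentSubgraph {H K : SimpleGraph V} (hKH : K ≤ H) {r v : V}
    (hv : v ∈ (componentSubgraph hKH r).verts) :
    (componentSubgraph hKH r).neighborSet v = K.neighborSet v := by
  ext w
  exact and_iff_left hv

/-- If every edge of `K` is needed to connect two vertices reachable from `r`, then the component
of `r` contains all edges of `K`. -/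
lemma edgeSet_componentSubgraph {H K : SimpleGraph V} (hKH : K ≤ H) {r : V} {A : Set V}
    (hA : ∀ u ∈ A, ∀ w ∈ A, K.Reachable u w) (hr : ∀ u ∈ A, K.Reachable r u)
    (h : ∀ e ∈ K.edgeSet, ∃ u ∈ A, ∃ w ∈ A, ¬ (K.deleteEdges {e}).Reachable u w) :
    (componentSubgraph hKH r).edgeSet = K.edgeSet := by
  classical
  ext e
  induction e with
  | h x y =>
  rw [Subgraph.mem_edgeSet, mem_edgeSet]
  refine and_iff_left_of_imp fun hxy => ?_
  rw [ConnectedComponent.mem_supp_iff, ConnectedComponent.eq]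
  obtain ⟨u, hu, w, hw, hne⟩ := h s(x, y) hxy
  obtain ⟨p⟩ := hA u hu w hw
  have hmem : s(x, y) ∈ p.edges := by
    by_contra hnot
    refine hne ⟨p.transfer _ fun e he => ?_⟩
    rw [edgeSet_deleteEdges]
    exact ⟨p.edges_subset_edgeSet he, fun hh => hnot ((Set.mem_singleton_iff.1 hh) ▸ he)⟩
  have hx := p.fst_mem_support_of_mem_edges hmem
  exact ((hr u hu).trans ⟨p.takeUntil x hx⟩).symm

/-- In a forest whose edges are linked to each other through vertices outside `R`, no vertex of `R`
has two neighbours. -/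
lemma notMem_of_adj_of_adj {K : SimpleGraph V} (hK : K.IsAcyclic) {R : Set V} {ι : Type*}
    {ε : ι → Sym2 V} {I : Set ι} (hI : ∀ e, e ∈ K.edgeSet ↔ ∃ i ∈ I, ε i = e)
    (hlink : ∀ i ∈ I, ∀ j ∈ I,
      Relation.ReflTransGen (fun a b => b ∈ I ∧ ∃ v, v ∉ R ∧ v ∈ ε a ∧ v ∈ ε b) i j)
    {v x y : V} (hx : K.Adj v x) (hy : K.Adj v y) (hxy : x ≠ y) : v ∉ R := by
  intro hvR
  obtain ⟨i, hi, hix⟩ := (hI s(v, x)).1 hx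
  obtain ⟨j, hj, hjy⟩ := (hI s(v, y)).1 hy
  have key : ∀ k, Relation.ReflTransGen
      (fun a b => b ∈ I ∧ ∃ v, v ∉ R ∧ v ∈ ε a ∧ v ∈ ε b) i k →
      ∀ z ∈ ε k, z ≠ v → (K.deleteEdges {s(v, x)}).Reachable x z := by
    intro k hk
    induction hk with
    | refl =>
      intro z hz hzv
      rw [hix, Sym2.mem_iff] at hz
      rw [hz.resolve_left hzv]
    | @tail b c _ hbc ih =>
      obtain ⟨hc, v', hv'R, hv'b, hv'c⟩ := hbc
      intro z hz hzv
      have hv'v : v' ≠ v := fun h => hv'R (h ▸ hvR)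
      refine (ih v' hv'b hv'v).trans ?_
      by_cases hzv' : v' = z
      · rw [hzv']
      · have hcz : ε c = s(v', z) := (Sym2.mem_and_mem_iff hzv').1 ⟨hv'c, hz⟩
        refine Adj.reachable (deleteEdges_adj.2 ⟨(hI s(v', z)).2 ⟨c, hc, hcz⟩, ?_⟩)
        simp [hv'v, hzv]
  have hxy' := key j (hlink i hi j hj) y (by simp [hjy]) hy.ne'
  have hvy : (K.deleteEdges {s(v, x)}).Adj v y :=
    deleteEdges_adj.2 ⟨hy, by simp [hxy.symm, hx.ne]⟩
  exact isBridge_iff.1 (isAcyclic_iff_forall_isBridge.1 hK hx) (hvy.reachable.trans hxy'.symm)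

end Trees

/-- Any minimal feasible EC-SNDP solution `H` decomposes into pairwise
edge-disjoint trees `T₁, …, T_b` whose leaves are terminals and whose internal
vertices are Steiner vertices; moreover for every terminal pair there are
`d s t` edge-disjoint paths in `H` such that each tree's edge set meets the
edge set of at most one of these paths. -/
theorem ec_minimal_solution_tree_partition {V : Type*} [Fintype V] [DecidableEq V]
    (G H : SimpleGraph V) (R : Set V) (d : V → V → ℕ)
    (hHG : H ≤ G)
    (hfeas : ECFeasible H R d)
    (hmin : ∀ e ∈ H.edgeSet, ¬ ECFeasible (H.deleteEdges {e}) R d) :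
    ∃ (b : ℕ) (T : Fin b → H.Subgraph),
      (∀ i, ((T i).coe).IsTree) ∧
      (H.edgeSet = ⋃ i, (T i).edgeSet) ∧
      (∀ i j, i ≠ j → ∀ e, e ∈ (T i).edgeSet → e ∉ (T j).edgeSet) ∧
      (∀ i, ∀ v ∈ (T i).verts, ((T i).neighborSet v).ncard = 1 → v ∈ R) ∧
      (∀ i, ∀ v ∈ (T i).verts, 2 ≤ ((T i).neighborSet v).ncard → v ∉ R) ∧
      (∀ s ∈ R, ∀ t ∈ R, s ≠ t → ∃ P : Fin (d s t) → H.Walk s t,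
        EdgeDisjPaths H s t (d s t) P ∧
        ∀ i : Fin b, {j | ∃ e ∈ (P j).edges, e ∈ (T i).edgeSet}.Subsingleton) := by
  classical
  obtain ⟨A, I, hI, hA, hAR⟩ := exists_aggregates_subset hfeas.meetsDemands
  set K : H.edgeSet → SimpleGraph V := fun i => ⨆ j ∈ I i, fromEdgeSet {(j : Sym2 V)} with hKdef
  have hKI : ∀ i e, e ∈ (K i).edgeSet ↔ ∃ j ∈ I i, (j : Sym2 V) = e := by
    intro i e
    induction e with
    | h u w =>
    simp only [hKdef, mem_edgeSet, iSup_adj, fromEdgeSet_adj, Set.mem_singleton_iff, exists_prop]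
    refine exists_congr fun j => and_congr_right fun _ => ⟨fun h => h.1.symm, fun h => ⟨h.symm, ?_⟩⟩
    have := j.2
    rw [h, mem_edgeSet] at this
    exact this.ne
  have hfam : ConnectingFamily H R d K A := by
    refine ⟨fun i u w huw => ?_, fun i j hij e hei hej => ?_, fun i u hu w hw => ?_, hA⟩
    · obtain ⟨j, -, hj⟩ := (hKI i s(u, w)).1 huw
      have := j.2
      rwa [hj] at this
    · obtain ⟨k, hk, hke⟩ := (hKI i e).1 hei
      obtain ⟨l, hl, hle⟩ := (hKI j e).1 hej
      exact hI.disjoint i j hij k hk (Subtype.ext (hke.trans hle.symm) ▸ hl)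
    · refine hI.reachable (fun j u hu w hw => ?_) i hu hw
      by_cases huw : u = w
      · rw [huw]
      · refine Adj.reachable ((fromEdgeSet_adj _).2 ⟨?_, huw⟩)
        rw [Sym2.mem_toFinset] at hu hw
        exact ((Sym2.mem_and_mem_iff huw).1 ⟨hu, hw⟩).symm
  have hneed : ∀ i, ∀ e ∈ (K i).edgeSet, ∃ u ∈ (A i : Set V), ∃ w ∈ (A i : Set V),
      ¬ ((K i).deleteEdges {e}).Reachable u w :=
    fun i e he => hfam.exists_not_reachable hmin he
  have hacyc : ∀ i, (K i).IsAcyclic := fun i =>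
    isAcyclic_of_exists_not_reachable (hfam.reachable i) (hneed i)
  have hroot : ∀ i, ∃ r, ∀ u ∈ (A i : Set V), (K i).Reachable r u := fun i => by
    by_cases hne : (A i).Nonempty
    · obtain ⟨r, hr⟩ := hne
      exact ⟨r, hfam.reachable i r hr⟩
    · rw [Finset.not_nonempty_iff_eq_empty] at hne
      exact ⟨(i : Sym2 V).out.1, by simp [hne]⟩
  choose r hr using hroot
  let T : H.edgeSet → H.Subgraph := fun i => componentSubgraph (hfam.le i) (r i)
  have hT : ∀ i, (T i).edgeSet = (K i).edgeSet := fun i =>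
    edgeSet_componentSubgraph (hfam.le i) (hfam.reachable i) (hr i) (hneed i)
  let φ := (Fintype.equivFin H.edgeSet).symm
  refine ⟨_, fun i => T (φ i), fun i => componentSubgraph_coe_isTree _ _ (hacyc _), ?_, ?_, ?_, ?_,
    ?_⟩
  · rw [φ.surjective.iUnion_comp fun i => (T i).edgeSet]
    ext e
    simp only [Set.mem_iUnion, hT]
    exact ⟨hfam.exists_mem_edgeSet hmin, fun ⟨i, hi⟩ => edgeSet_mono (hfam.le i) hi⟩
  · intro i j hij
    rw [hT, hT]
    exact hfam.disjoint _ _ (φ.injective.ne hij)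
  · intro i v hv hcard
    rw [neighborSet_componentSubgraph _ hv] at hcard
    obtain ⟨x, hx⟩ := Set.ncard_eq_one.1 hcard
    exact hAR _ _ (mem_of_neighborSet_eq_singleton (hfam.reachable _) (hneed _) hx)
  · intro i v hv hcard
    rw [neighborSet_componentSubgraph _ hv] at hcard
    obtain ⟨x, hx, y, hy, hxy⟩ := (Set.one_lt_ncard (Set.toFinite _)).1 hcard
    refine notMem_of_adj_of_adj (hacyc _) (hKI (φ i)) ?_ hx hy hxy
    simpa only [Sym2.mem_toFinset] using hI.linked (φ i)
  · intro s hs t ht hst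
    obtain ⟨P, hP, hsub⟩ := exists_edgeDisjPaths_of_le_hyperCut hfam.le hfam.disjoint hfam.reachable
      hst fun X hX => hA s hs t ht X hX
    refine ⟨P, hP, fun i => ?_⟩
    rw [hT]
    exact hsub _
end
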